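/- Let μ ∈ {μ₁, μ₂} and let w ∈ Perm^sp(μ) not be a translation element (equivalently, the image of w in S^h_{2n} is nontrivial; equivalently, some m ∈ {1,…,2n} is proper). Then there exist 1 ≤ i < j ≤ 2n with j ≠ i* and d ∈ {0, −1} such that s_{i,j;d}w ∈ Perm^sp(μ) and w < s_{i,j;d}w in the Bruhat order. -/

import Mathlib

open Finset

namespace OrthLM

/-- Membership in the cocharacter lattice `X` of the standard maximal torus of `GO_{2n}`:
integer vectors with `r_i + r_{i*}` independent of `i`. -/
def inX (n : ℕ) (v : Fin (2*n) → ℤ) : Prop :=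
  ∀ i j : Fin (2*n), v i + v i.rev = v j + v j.rev

/-- Membership in `S^h_{2n}`: permutations commuting with the involution `i ↦ i* = 2n+1-i`. -/
def inSh (n : ℕ) (σ : Equiv.Perm (Fin (2*n))) : Prop :=
  ∀ i, σ i.rev = (σ i).rev

/-- Membership in `W°`: elements of `S^h_{2n}` that are even as permutations. -/
def inW0 (n : ℕ) (σ : Equiv.Perm (Fin (2*n))) : Prop :=
  inSh n σ ∧ Equiv.Perm.sign σ = 1

/-- Elements of the ambient group of the Iwahori-Weyl group `W̃ = X ⋊ S^h_{2n}`,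
represented as pairs (translation part, finite part). -/
abbrev Wt (n : ℕ) := (Fin (2*n) → ℤ) × Equiv.Perm (Fin (2*n))

/-- Membership in the Iwahori-Weyl group `W̃ = X ⋊ S^h_{2n}`. -/
def inWt (n : ℕ) (w : Wt n) : Prop := inX n w.1 ∧ inSh n w.2

def wone (n : ℕ) : Wt n := (0, 1)

/-- Multiplication in `W̃` (compatible with the affine action `(v,σ)·x = v + σx`). -/
def wmul (n : ℕ) (w w' : Wt n) : Wt n :=
  (fun i => w.1 i + w'.1 (w.2⁻¹ i), w.2 * w'.2)

/-- Inversion in `W̃`. -/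
def winv (n : ℕ) (w : Wt n) : Wt n := (fun i => -(w.1 (w.2 i)), w.2⁻¹)

/-- The translation element `t_μ`. -/
def wtrans (n : ℕ) (μ : Fin (2*n) → ℤ) : Wt n := (μ, 1)

/-- A finite Weyl group element regarded in `W̃`. -/
def wperm (n : ℕ) (σ : Equiv.Perm (Fin (2*n))) : Wt n := (0, σ)

/-- The affine action of `W̃` on `ℤ^{2n}`: `(v,σ)·x = v + σx` with `(σx)(i) = x(σ⁻¹ i)`. -/
def wact (n : ℕ) (w : Wt n) (x : Fin (2*n) → ℤ) : Fin (2*n) → ℤ :=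
  fun i => w.1 i + x (w.2⁻¹ i)

/-- The affine action of `W̃` on `ℝ^{2n}`. -/
def wactR (n : ℕ) (w : Wt n) (x : Fin (2*n) → ℝ) : Fin (2*n) → ℝ :=
  fun i => (w.1 i : ℝ) + x (w.2⁻¹ i)

/-- The action of a permutation on vectors: `(σμ)(i) = μ(σ⁻¹ i)`. -/
def permAct (n : ℕ) (σ : Equiv.Perm (Fin (2*n))) (μ : Fin (2*n) → ℤ) : Fin (2*n) → ℤ :=
  fun i => μ (σ⁻¹ i)

/-- The cocharacter `μ₁ = (1^{(n)}, 0^{(n)})`. -/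
def mu1 (n : ℕ) : Fin (2*n) → ℤ := fun j => if (j:ℕ) < n then 1 else 0

/-- The cocharacter `μ₂ = (1^{(n-1)}, 0, 1, 0^{(n-1)})`. -/
def mu2 (n : ℕ) : Fin (2*n) → ℤ := fun j => if (j:ℕ) < n - 1 ∨ (j:ℕ) = n then 1 else 0

/-- The vertices `ω_k = ((-1)^{(k)}, 0^{(2n-k)})` of the standard extended alcove. -/
def om (n : ℕ) (k : ℕ) : Fin (2*n) → ℤ := fun j => if (j:ℕ) < k then -1 else 0

/-- The extended alcove `v_k = w·ω_k` of `w`. -/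
def valc (n : ℕ) (w : Wt n) (k : ℕ) : Fin (2*n) → ℤ := wact n w (om n k)

/-- The vector `μ_k^w = v_k - ω_k`. -/
def muk (n : ℕ) (w : Wt n) (k : ℕ) : Fin (2*n) → ℤ :=
  fun j => valc n w k j - om n k j

/-- The set `E_k^w = {j : μ_k^w(j) = 0}`. -/
def Ew (n : ℕ) (w : Wt n) (k : ℕ) : Finset (Fin (2*n)) :=
  univ.filter fun j => muk n w k j = 0

/-- `GL`-permissibility: `Σ v_0 = n` and `ω_k ≤ v_k ≤ ω_k + (1,…,1)` for `0 ≤ k ≤ 2n-1`. -/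
def GLperm (n : ℕ) (w : Wt n) : Prop :=
  (∑ j, valc n w 0 j) = (n : ℤ) ∧
  ∀ k < 2*n, ∀ j, om n k j ≤ valc n w k j ∧ valc n w k j ≤ om n k j + 1

/-- A vector `μ ∈ {0,1}^{2n}` is totally isotropic if `μ(j) + μ(j*) = 1` for all `j`. -/
def TotIso (n : ℕ) (μ : Fin (2*n) → ℤ) : Prop := ∀ j, μ j + μ j.rev = 1

/-- `μ`-spin-permissibility: `GL`-permissible and every totally isotropic `μ_k^w`
(for `0 ≤ k ≤ n`) lies in the `W°`-orbit of `μ`. -/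
def SpinPerm (n : ℕ) (μ : Fin (2*n) → ℤ) (w : Wt n) : Prop :=
  GLperm n w ∧ ∀ k ≤ n, TotIso n (muk n w k) →
    ∃ σ, inW0 n σ ∧ muk n w k = permAct n σ μ

/-- Membership in the coroot lattice `Q^∨`. -/
def inQv (n : ℕ) (v : Fin (2*n) → ℤ) : Prop :=
  inX n v ∧ (∀ i, v i + v i.rev = 0) ∧
  Even (∑ i ∈ univ.filter (fun i : Fin (2*n) => (i:ℕ) < n), v i)

/-- Membership in the affine Weyl group `W_a = Q^∨ ⋊ W°`. -/
def inWa (n : ℕ) (x : Wt n) : Prop := inQv n x.1 ∧ inW0 n x.2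

/-- The affine reflection `s_{i,j;d}` (for `j ∉ {i, i*}`), sending `x` to the vector with
`x_j + d` in slot `i`, `x_i - d` in slot `j`, `x_{i*} + d` in slot `j*`, `x_{j*} - d` in
slot `i*`. -/
def wrefl (n : ℕ) (i j : Fin (2*n)) (d : ℤ) : Wt n :=
  (fun l => if l = i then d else if l = j then -d else if l = j.rev then d
            else if l = i.rev then -d else 0,
   Equiv.swap i j * Equiv.swap i.rev j.rev)

/-- Successor modulo `2n` on representatives `{0,…,2n-1}` of `ℤ/2nℤ`. -/
def csucc (n : ℕ) (k : Fin (2*n)) : Fin (2*n) :=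
  ⟨((k:ℕ) + 1) % (2*n), Nat.mod_lt _ k.pos⟩

/-- Predecessor modulo `2n`. -/
def cpred (n : ℕ) (k : Fin (2*n)) : Fin (2*n) :=
  ⟨((k:ℕ) + (2*n - 1)) % (2*n), Nat.mod_lt _ k.pos⟩

/-- Negation modulo `2n`. -/
def cneg (n : ℕ) (k : Fin (2*n)) : Fin (2*n) :=
  ⟨(2*n - (k:ℕ)) % (2*n), Nat.mod_lt _ k.pos⟩

/-- The star involution on classes mod `2n`: the class of `m` goes to the class of
`m* = 2n+1-m`, i.e. `c ↦ 1 - c`. -/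
def cstar (n : ℕ) (k : Fin (2*n)) : Fin (2*n) := csucc n (cneg n k)

/-- The representative in `{1,…,2n}` of a class mod `2n`. -/
def pv (n : ℕ) (k : Fin (2*n)) : ℕ := if (k:ℕ) = 0 then 2*n else (k:ℕ)

/-- The cyclic interval `[a, b)` in `ℤ/2nℤ`. -/
def cyc (n : ℕ) (a b : Fin (2*n)) : Finset (Fin (2*n)) :=
  univ.filter fun k => ((k:ℕ) + 2*n - (a:ℕ)) % (2*n) < ((b:ℕ) + 2*n - (a:ℕ)) % (2*n)

/-- The set `K_m = {k ∈ ℤ/2nℤ : μ_k^w(m) = 0}` (indices `m` are 0-indexed: the slot `m`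
corresponds to the paper's `m+1 ∈ {1,…,2n}`; classes are represented by `{0,…,2n-1}`). -/
def Kset (n : ℕ) (w : Wt n) (m : Fin (2*n)) : Finset (Fin (2*n)) :=
  univ.filter fun k => muk n w (k:ℕ) m = 0

/-- The slot `m` is proper: `K_{m+1}` (paper indexing) is a cyclic interval `[m̃, m+1)`
with lower endpoint `m̃` different from the class of `m+1`. -/
def isProper (n : ℕ) (w : Wt n) (m : Fin (2*n)) : Prop :=
  ∃ mt, mt ≠ csucc n m ∧ Kset n w m = cyc n mt (csucc n m)

/-- The constraint cutting out `X ⊗ ℝ` inside `ℝ^{2n}`. -/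
def inXR (n : ℕ) (x : Fin (2*n) → ℝ) : Prop :=
  ∀ i j : Fin (2*n), x i + x i.rev = x j + x j.rev

/-- The closure (in `X ⊗ ℝ`, lifted to `ℝ^{2n}`) of the preimage `Ã` of the base alcove:
the points of `X ⊗ ℝ` on which every positive root `x_i - x_j`, `x_i + x_j - c(x)`
(`1 ≤ i < j ≤ n`) takes values in `[-1, 0]`. -/
def ClA (n : ℕ) : Set (Fin (2*n) → ℝ) :=
  {x | inXR n x ∧
       ∀ i j : Fin (2*n), i < j → (j:ℕ) < n →
         (-1 ≤ x i - x j ∧ x i - x j ≤ 0 ∧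
          -1 ≤ x i + x j - (x i + x i.rev) ∧ x i + x j - (x i + x i.rev) ≤ 0)}

/-- The stabilizer `Ω` in `W̃` of the base alcove. -/
def inOmega (n : ℕ) (w : Wt n) : Prop :=
  inWt n w ∧ (wactR n w) '' ClA n = ClA n

/-- The Coxeter generators of `W_a`: the reflections in the walls of the base alcove,
namely `s_{i,i+1;0}` for `1 ≤ i ≤ n-1`, `s_{n-1,n+1;0}`, and `s_{1,2n-1;-1}`
(paper 1-indexed; here 0-indexed). -/
def sgens (n : ℕ) (hn : 2 ≤ n) : Set (Wt n) :=
  {w | (∃ i : Fin (2*n), (i:ℕ) + 1 < n ∧ w = wrefl n i (csucc n i) 0) ∨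
       w = wrefl n ⟨n-2, by omega⟩ ⟨n, by omega⟩ 0 ∨
       w = wrefl n ⟨0, by omega⟩ ⟨2*n-2, by omega⟩ (-1)}

def wprod (n : ℕ) (L : List (Wt n)) : Wt n := L.foldr (wmul n) (wone n)

/-- A word in the Coxeter generators of `W_a`. -/
def isWord (n : ℕ) (hn : 2 ≤ n) (L : List (Wt n)) : Prop := ∀ s ∈ L, s ∈ sgens n hn

/-- The length function on `W̃`: `ℓ(xω) = ℓ(x)` for `x ∈ W_a`, `ω ∈ Ω`, where `ℓ(x)` is
the minimal length of a word in the Coxeter generators expressing `x`. -/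
noncomputable def lenW (n : ℕ) (hn : 2 ≤ n) (w : Wt n) : ℕ :=
  sInf {m | ∃ L ω, isWord n hn L ∧ L.length = m ∧ inOmega n ω ∧ w = wmul n (wprod n L) ω}

/-- The Bruhat order on `W̃`: `xω ≤ x'ω'` iff `ω = ω'` and `x ≤ x'` in `W_a`, the latter
expressed by the subword property for a reduced word of `x'`. -/
def wle (n : ℕ) (hn : 2 ≤ n) (w w' : Wt n) : Prop :=
  ∃ L ω, isWord n hn L ∧ inOmega n ω ∧ w' = wmul n (wprod n L) ω ∧
    L.length = lenW n hn w' ∧ ∃ L', L'.Sublist L ∧ w = wmul n (wprod n L') ω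

/-- Strict Bruhat order on `W̃`. -/
def wlt (n : ℕ) (hn : 2 ≤ n) (w w' : Wt n) : Prop := wle n hn w w' ∧ w ≠ w'

/-- The `μ`-admissible set `Adm°(μ)` for `G°`: `w ≤ σ t_μ σ⁻¹` for some `σ ∈ W°`. -/
def AdmO (n : ℕ) (hn : 2 ≤ n) (μ : Fin (2*n) → ℤ) (w : Wt n) : Prop :=
  ∃ σ, inW0 n σ ∧
    wle n hn w (wmul n (wperm n σ) (wmul n (wtrans n μ) (wperm n σ⁻¹)))

/-- The `μ`-admissible set `Adm(μ)` for `G`: `w ≤ σ t_μ σ⁻¹` for some `σ ∈ S^h_{2n}`. -/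
def AdmFull (n : ℕ) (hn : 2 ≤ n) (μ : Fin (2*n) → ℤ) (w : Wt n) : Prop :=
  ∃ σ, inSh n σ ∧
    wle n hn w (wmul n (wperm n σ) (wmul n (wtrans n μ) (wperm n σ⁻¹)))

/-- The element `τ = (n, n+1) ∈ S^h_{2n}` (paper 1-indexed). -/
def tau (n : ℕ) (hn : 2 ≤ n) : Equiv.Perm (Fin (2*n)) :=
  Equiv.swap ⟨n-1, by omega⟩ ⟨n, by omega⟩

lemma rev_ne {n : ℕ} (i : Fin (2*n)) : i.rev ≠ i := by
  intro h
  have := congrArg Fin.val h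
  rw [Fin.val_rev] at this
  omega

lemma inv_rev {n : ℕ} {σ : Equiv.Perm (Fin (2*n))} (h : inSh n σ) (l : Fin (2*n)) :
    σ⁻¹ l.rev = (σ⁻¹ l).rev := by
  rw [Equiv.Perm.inv_eq_iff_eq, h]; simp

lemma wmul_assoc {n : ℕ} (x y z : Wt n) :
    wmul n (wmul n x y) z = wmul n x (wmul n y z) := by
  ext i <;> simp [wmul, add_assoc]

lemma one_wmul {n : ℕ} (x : Wt n) : wmul n (wone n) x = x := by
  ext i <;> simp [wmul, wone]

/-- The value of the inverse finite part of the reflection `s_{i,j;d}`. -/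
lemma wrefl_inv_apply {n : ℕ} {i j : Fin (2*n)} (hij : i ≠ j) (hij' : j ≠ i.rev) (d : ℤ)
    (l : Fin (2*n)) :
    (wrefl n i j d).2⁻¹ l =
      if l = i then j else if l = j then i else if l = j.rev then i.rev
      else if l = i.rev then j.rev else l := by
  have h1 := rev_ne i
  have h2 := rev_ne j
  have h3 : j.rev ≠ i := fun h => hij' (by rw [← h, Fin.rev_rev])
  simp only [wrefl, mul_inv_rev, Equiv.swap_inv, Equiv.Perm.mul_apply]
  simp only [Equiv.swap_apply_def]
  grind

lemma wrefl_fst {n : ℕ} (i j : Fin (2*n)) (d : ℤ) (l : Fin (2*n)) :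
    (wrefl n i j d).1 l = if l = i then d else if l = j then -d else if l = j.rev then d
      else if l = i.rev then -d else 0 := rfl

lemma wrefl_inv_snd {n : ℕ} {i j : Fin (2*n)} (hij : i ≠ j) (hij' : j ≠ i.rev) (d : ℤ) :
    (wrefl n i j d).2⁻¹ = (wrefl n i j d).2 := by
  have h3 : j.rev ≠ i := fun h => hij' (by rw [← h, Fin.rev_rev])
  have : Equiv.Perm.Disjoint (Equiv.swap i j) (Equiv.swap i.rev j.rev) := by
    have h1 := rev_ne i
    have h2 := rev_ne j
    intro x
    simp only [Equiv.swap_apply_def]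
    split_ifs <;> simp_all
  simp only [wrefl, mul_inv_rev, Equiv.swap_inv]
  exact this.commute.eq.symm

/-- Conjugating an affine reflection by an element of `W̃`. -/
lemma wrefl_wmul {n : ℕ} {i j : Fin (2*n)} (hij : i ≠ j) (hij' : j ≠ i.rev) (d : ℤ)
    {u : Wt n} (hu : inWt n u) :
    wmul n (wrefl n i j d) u =
      wmul n u (wrefl n (u.2⁻¹ i) (u.2⁻¹ j) (d - u.1 i + u.1 j)) := by
  have hr := inv_rev hu.2
  have e1 := hu.1 i j
  have h1 := rev_ne i
  have h2 := rev_ne j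
  have h3 : j.rev ≠ i := fun h => hij' (by rw [← h, Fin.rev_rev])
  refine Prod.ext ?_ ?_
  · funext l
    simp only [wmul, wrefl_inv_apply hij hij', wrefl_fst, ← hr, (u.2⁻¹).injective.eq_iff]
    split_ifs <;> simp_all <;> omega
  · simp only [wmul, wrefl, ← hr]
    have key : ∀ a b, Equiv.swap a b * u.2 = u.2 * Equiv.swap (u.2⁻¹ a) (u.2⁻¹ b) := by
      intro a b
      rw [Equiv.mul_swap_eq_swap_mul]; simp
    rw [mul_assoc, key, ← mul_assoc, key, mul_assoc]

lemma wrefl_wmul_self {n : ℕ} {i j : Fin (2*n)} (hij : i ≠ j) (hij' : j ≠ i.rev) (d : ℤ) :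
    wmul n (wrefl n i j d) (wrefl n i j d) = wone n := by
  have h1 := rev_ne i
  have h2 := rev_ne j
  have h3 : j.rev ≠ i := fun h => hij' (by rw [← h, Fin.rev_rev])
  refine Prod.ext ?_ ?_
  · funext l
    simp only [wmul, wrefl_inv_apply hij hij', wrefl_fst, wone, Pi.zero_apply]
    grind
  · simp only [wmul, wone]
    nth_rw 1 [← wrefl_inv_snd hij hij' d]
    simp

lemma inWt_wrefl {n : ℕ} {i j : Fin (2*n)} (hij : i ≠ j) (hij' : j ≠ i.rev) (d : ℤ) :
    inWt n (wrefl n i j d) := by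
  have h1 := rev_ne i
  have h2 := rev_ne j
  have h3 : j.rev ≠ i := fun h => hij' (by rw [← h, Fin.rev_rev])
  have key : ∀ l : Fin (2*n), (wrefl n i j d).1 l + (wrefl n i j d).1 l.rev = 0 := by
    intro l
    have e1 : l.rev = i ↔ l = i.rev := Fin.rev_eq_iff
    have e2 : l.rev = j ↔ l = j.rev := Fin.rev_eq_iff
    simp only [wrefl_fst, Fin.rev_inj, e1, e2]
    split_ifs <;> simp_all
  refine ⟨fun l m => by rw [key, key], fun l => ?_⟩
  rw [← wrefl_inv_snd hij hij' d]
  have e1 : l.rev = i ↔ l = i.rev := Fin.rev_eq_iff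
  have e2 : l.rev = j ↔ l = j.rev := Fin.rev_eq_iff
  simp only [wrefl_inv_apply hij hij', Fin.rev_inj, e1, e2]
  grind [Fin.rev_rev]

lemma inWt_wmul {n : ℕ} {u w : Wt n} (hu : inWt n u) (hw : inWt n w) : inWt n (wmul n u w) := by
  have hr := inv_rev hu.2
  refine ⟨fun i j => ?_, fun i => ?_⟩
  · have e1 := hu.1 i j
    have e2 := hw.1 (u.2⁻¹ i) (u.2⁻¹ j)
    simp only [wmul, hr]
    omega
  · simp only [wmul, Equiv.Perm.mul_apply, hw.2 i, hu.2 _]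

/-- The image under `w` of an interior point of the base alcove, rescaled by `2n` and
translated by a multiple of `(1,…,1)`. -/
def alcPt (n : ℕ) (w : Wt n) (j : Fin (2*n)) : ℤ := 2*n * w.1 j + ((w.2⁻¹ j : Fin (2*n)) : ℕ)

/-- The position of the alcove of `w` relative to the hyperplane of `s_{i,j;d}`. -/
def side (n : ℕ) (i j : Fin (2*n)) (d : ℤ) (w : Wt n) : ℤ :=
  alcPt n w i - alcPt n w j - 2*n*d

lemma alcPt_wmul {n : ℕ} (u w : Wt n) (i : Fin (2*n)) :
    alcPt n (wmul n u w) i = 2*n * u.1 i + alcPt n w (u.2⁻¹ i) := by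
  simp only [alcPt, wmul, mul_inv_rev, Equiv.Perm.mul_apply]; ring

lemma alcPt_add_rev {n : ℕ} {w : Wt n} (hw : inWt n w) (i j : Fin (2*n)) :
    alcPt n w i + alcPt n w i.rev = alcPt n w j + alcPt n w j.rev := by
  have hr := inv_rev hw.2
  simp only [alcPt, hr, Fin.val_rev]
  have := hw.1 i j
  have h1 := (w.2⁻¹ i).isLt
  have h2 := (w.2⁻¹ j).isLt
  push_cast [Nat.cast_sub h1, Nat.cast_sub h2]
  have h3 : 2*(n:ℤ)*w.1 i + 2*n*w.1 i.rev = 2*n*w.1 j + 2*n*w.1 j.rev := by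
    rw [← mul_add, ← mul_add, this]
  omega

lemma side_wmul {n : ℕ} (i j : Fin (2*n)) (d : ℤ) (u w : Wt n) :
    side n i j d (wmul n u w) = side n (u.2⁻¹ i) (u.2⁻¹ j) (d - u.1 i + u.1 j) w := by
  simp only [side, alcPt_wmul]; ring

lemma side_ne_zero {n : ℕ} {i j : Fin (2*n)} (hij : i ≠ j) (d : ℤ) (w : Wt n) :
    side n i j d w ≠ 0 := by
  intro h
  have hne : w.2⁻¹ i ≠ w.2⁻¹ j := (w.2⁻¹).injective.ne hij
  have hne' : ((w.2⁻¹ i : Fin (2*n)) : ℕ) ≠ ((w.2⁻¹ j : Fin (2*n)) : ℕ) := fun h => hne (Fin.ext h)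
  have h1 := (w.2⁻¹ i).isLt
  have h2 := (w.2⁻¹ j).isLt
  simp only [side, alcPt] at h
  have h' : (2*n:ℤ) * (w.1 j - w.1 i + d)
      = ((w.2⁻¹ i : Fin (2*n)) : ℕ) - ((w.2⁻¹ j : Fin (2*n)) : ℕ) := by linarith
  have hdvd : (2*n:ℤ) ∣ ((w.2⁻¹ i : Fin (2*n)) : ℕ) - ((w.2⁻¹ j : Fin (2*n)) : ℕ) :=
    ⟨_, h'.symm⟩
  have := Int.eq_zero_of_abs_lt_dvd hdvd (by rw [abs_lt]; constructor <;> omega)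
  omega

lemma side_wrefl_wmul {n : ℕ} {i j : Fin (2*n)} (hij : i ≠ j) (hij' : j ≠ i.rev) (d : ℤ)
    (w : Wt n) : side n i j d (wmul n (wrefl n i j d) w) = - side n i j d w := by
  simp only [side_wmul, wrefl_inv_apply hij hij', wrefl_fst]
  simp [hij.symm, side]
  ring

lemma alcPt_one {n : ℕ} (j : Fin (2*n)) : alcPt n (wone n) j = (j : ℕ) := by
  simp [alcPt, wone]

/-- The parameters of the Coxeter generators. -/
lemma exists_params_of_mem_sgens {n : ℕ} {hn : 2 ≤ n} {s : Wt n} (hs : s ∈ sgens n hn) :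
    ∃ (i j : Fin (2*n)) (d : ℤ), i ≠ j ∧ j ≠ i.rev ∧ s = wrefl n i j d ∧
      (((i:ℕ) + 1 < n ∧ (j:ℕ) = i + 1 ∧ d = 0) ∨ ((i:ℕ) = n - 2 ∧ (j:ℕ) = n ∧ d = 0) ∨
        ((i:ℕ) = 0 ∧ (j:ℕ) = 2*n - 2 ∧ d = -1)) := by
  have hne : ∀ {i j : Fin (2*n)}, (j:ℕ) ≠ 2*n - (i + 1) → j ≠ i.rev := by
    intro i j h h'
    rw [h', Fin.val_rev] at h
    exact h rfl
  rcases hs with ⟨i, hi, rfl⟩ | rfl | rfl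
  · have hv : ((csucc n i : Fin (2*n)) : ℕ) = i + 1 := Nat.mod_eq_of_lt (by omega)
    refine ⟨i, csucc n i, 0, ?_, hne (by omega), rfl, Or.inl ⟨hi, hv, rfl⟩⟩
    intro h
    have := congrArg Fin.val h
    omega
  · refine ⟨_, _, _, ?_, hne ?_, rfl, Or.inr (Or.inl ⟨rfl, rfl, rfl⟩)⟩
    · simp only [ne_eq, Fin.mk.injEq]; omega
    · show n ≠ 2*n - (n - 2 + 1); omega
  · refine ⟨_, _, _, ?_, hne ?_, rfl, Or.inr (Or.inr ⟨rfl, rfl, rfl⟩)⟩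
    · simp only [ne_eq, Fin.mk.injEq]; omega
    · show 2*n - 2 ≠ 2*n - (0 + 1); omega

lemma inWt_of_mem_sgens {n : ℕ} {hn : 2 ≤ n} {s : Wt n} (hs : s ∈ sgens n hn) : inWt n s := by
  obtain ⟨i, j, d, h1, h2, rfl, -⟩ := exists_params_of_mem_sgens hs
  exact inWt_wrefl h1 h2 d

lemma wmul_self_of_mem_sgens {n : ℕ} {hn : 2 ≤ n} {s : Wt n} (hs : s ∈ sgens n hn) :
    wmul n s s = wone n := by
  obtain ⟨i, j, d, h1, h2, rfl, -⟩ := exists_params_of_mem_sgens hs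
  exact wrefl_wmul_self h1 h2 d

lemma wrefl_symm {n : ℕ} {i j : Fin (2*n)} (hij : i ≠ j) (d : ℤ) :
    wrefl n j i (-d) = wrefl n i j d := by
  have h1 := rev_ne i
  have h2 := rev_ne j
  refine Prod.ext ?_ ?_
  · funext l
    simp only [wrefl_fst]
    grind
  · simp only [wrefl]; rw [Equiv.swap_comm, Equiv.swap_comm i.rev]

lemma wrefl_rev {n : ℕ} {i j : Fin (2*n)} (hij : i ≠ j) (hij' : j ≠ i.rev) (d : ℤ) :
    wrefl n j.rev i.rev d = wrefl n i j d := by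
  have h1 := rev_ne i
  have h2 := rev_ne j
  refine Prod.ext ?_ ?_
  · funext l
    simp only [wrefl_fst, Fin.rev_rev]
    grind
  · have := congrArg Inv.inv (wrefl_inv_snd hij hij' d)
    rw [inv_inv] at this
    rw [this]
    simp [wrefl, Equiv.swap_comm]

/-- The interior point of the alcove of a Coxeter generator, as a shift of that of the base
alcove. -/
lemma alcPt_wrefl {n : ℕ} {a b : Fin (2*n)} (hab : a ≠ b) (hab' : b ≠ a.rev) (e : ℤ)
    (l : Fin (2*n)) :
    alcPt n (wrefl n a b e) l = (l:ℕ) +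
      (if l = a then (b:ℕ) - (a:ℕ) + 2*n*e else if l = b then -((b:ℕ) - (a:ℕ) + 2*n*e)
        else if l = b.rev then (b:ℕ) - (a:ℕ) + 2*n*e
        else if l = a.rev then -((b:ℕ) - (a:ℕ) + 2*n*e) else 0 : ℤ) := by
  have h1 := a.isLt
  have h2 := b.isLt
  simp only [alcPt, wrefl_fst, wrefl_inv_apply hab hab']
  have e1 : ((a.rev : Fin (2*n)) : ℕ) + a + 1 = 2*n := by rw [Fin.val_rev]; omega
  have e2 : ((b.rev : Fin (2*n)) : ℕ) + b + 1 = 2*n := by rw [Fin.val_rev]; omega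
  zify at e1 e2
  split_ifs with h h h h
  · rw [h]; ring
  · rw [h]; ring
  · rw [h]; linarith
  · rw [h]; linarith
  · ring

set_option maxHeartbeats 2000000 in
/-- The parameters of a hyperplane separating the base alcove from an adjacent one. -/
lemma params_of_sign_change {n i j a b a' b' : ℕ} {d e c p q : ℤ} (hn : 2 ≤ n)
    (hi : i < 2*n) (hj : j < 2*n) (ha : a' + a + 1 = 2*n) (hb : b' + b + 1 = 2*n)
    (hij' : i + j + 1 ≠ 2*n)
    (hc : (a + 1 < n ∧ b = a + 1 ∧ e = 0 ∧ c = 1) ∨ (a = n - 2 ∧ b = n ∧ e = 0 ∧ c = 2) ∨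
      (a = 0 ∧ b = 2*n - 2 ∧ e = -1 ∧ c = -2))
    (hp : p = if i = a then c else if i = b then -c else if i = b' then c
      else if i = a' then -c else 0)
    (hq : q = if j = a then c else if j = b then -c else if j = b' then c
      else if j = a' then -c else 0)
    (h : ((i:ℤ) - j - 2*n*d) * ((i + p) - (j + q) - 2*n*d) < 0) :
    (i = a ∧ j = b ∧ d = e) ∨ (i = b ∧ j = a ∧ d = -e) ∨
      (i = b' ∧ j = a' ∧ d = e) ∨ (i = a' ∧ j = b' ∧ d = -e) := by
  have hd3 : (d = -1 ∨ d = 0 ∨ d = 1) := by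
    have hcb : -2 ≤ c ∧ c ≤ 2 := by omega
    have hpb : -2 ≤ p ∧ p ≤ 2 := by clear hq h hc; rw [hp]; split_ifs <;> omega
    have hqb : -2 ≤ q ∧ q ≤ 2 := by clear hp h hc; rw [hq]; split_ifs <;> omega
    clear hp hq hc
    have h' := mul_neg_iff.mp h
    obtain ⟨D, hD⟩ : ∃ D : ℤ, D = n * d := ⟨_, rfl⟩
    have hD2 : (2*n:ℤ)*d = 2 * D := by rw [hD]; ring
    rw [hD2] at h'
    clear h
    have h1 : ¬ d ≤ -2 := by
      intro hcon
      have : D ≤ -2 * n := by rw [hD]; nlinarith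
      omega
    have h2 : ¬ 2 ≤ d := by
      intro hcon
      have : 2 * n ≤ D := by rw [hD]; nlinarith
      omega
    omega
  have h' := mul_neg_iff.mp h
  clear h
  have hp' : (i = a ∧ p = c) ∨ (i = b ∧ p = -c) ∨ (i = b' ∧ p = c) ∨ (i = a' ∧ p = -c) ∨
      (p = 0 ∧ i ≠ a ∧ i ≠ b ∧ i ≠ b' ∧ i ≠ a') := by split_ifs at hp <;> simp_all
  have hq' : (j = a ∧ q = c) ∨ (j = b ∧ q = -c) ∨ (j = b' ∧ q = c) ∨ (j = a' ∧ q = -c) ∨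
      (q = 0 ∧ j ≠ a ∧ j ≠ b ∧ j ≠ b' ∧ j ≠ a') := by split_ifs at hq <;> simp_all
  clear hp hq
  have hpos : (i:ℤ) - j - 2*n*d < 0 ∧ 0 < (i + p) - (j + q) - 2*n*d ∨
    0 < (i:ℤ) - j - 2*n*d ∧ (i + p) - (j + q) - 2*n*d < 0 := by tauto
  clear h'
  rcases hp' with ⟨h1, h2⟩ | ⟨h1, h2⟩ | ⟨h1, h2⟩ | ⟨h1, h2⟩ | ⟨h1, h2, ha1, ha2, ha3⟩ <;>
  rcases hq' with ⟨h3, h4⟩ | ⟨h3, h4⟩ | ⟨h3, h4⟩ | ⟨h3, h4⟩ | ⟨h3, h4, hb1, hb2, hb3⟩ <;>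
  rcases hd3 with rfl | rfl | rfl <;> simp only [mul_zero, mul_neg, mul_one] at hpos <;>
  rcases hc with ⟨hx, hy, rfl, rfl⟩ | ⟨hx, hy, rfl, rfl⟩ | ⟨hx, hy, rfl, rfl⟩ <;>
  rcases hpos with ⟨hu, hv⟩ | ⟨hu, hv⟩ <;>
  first
  | exact Or.inl ⟨h1, h3, rfl⟩
  | exact Or.inr (Or.inl ⟨h1, h3, rfl⟩)
  | exact Or.inr (Or.inr (Or.inl ⟨h1, h3, rfl⟩))
  | exact Or.inr (Or.inr (Or.inr ⟨h1, h3, rfl⟩))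
  | (exfalso; omega)

/-- The alcoves of `1` and of a Coxeter generator `s` are separated by only one hyperplane. -/
lemma eq_of_side_mul_side_neg {n : ℕ} {hn : 2 ≤ n} {s : Wt n} (hs : s ∈ sgens n hn)
    {i j : Fin (2*n)} (hij' : j ≠ i.rev) {d : ℤ}
    (h : side n i j d (wone n) * side n i j d s < 0) : wrefl n i j d = s := by
  obtain ⟨a, b, e, h1, h2, rfl, hc⟩ := exists_params_of_mem_sgens hs
  have hra := Fin.val_rev a
  have hrb := Fin.val_rev b
  have hri := Fin.val_rev i
  have hij1 : (j:ℕ) ≠ i.rev := fun h => hij' (Fin.ext h)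
  have hcase := params_of_sign_change (a := a) (b := b) (a' := a.rev) (b' := b.rev) (e := e)
    (c := (b:ℕ) - (a:ℕ) + 2*n*e) (d := d) hn i.isLt j.isLt (by omega) (by omega) (by omega)
    (by rcases hc with ⟨_, _, rfl⟩ | ⟨_, _, rfl⟩ | ⟨_, _, rfl⟩ <;> omega) rfl rfl (by
      simpa only [side, alcPt_one, alcPt_wrefl h1 h2, Fin.ext_iff] using h)
  simp only [← Fin.ext_iff] at hcase
  rcases hcase with ⟨hia, hjb, hde⟩ | ⟨hia, hjb, hde⟩ | ⟨hia, hjb, hde⟩ | ⟨hia, hjb, hde⟩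
  · rw [hia, hjb, hde]
  · rw [hia, hjb, hde]; exact wrefl_symm h1 e
  · rw [hia, hjb, hde]; exact wrefl_rev h1 h2 e
  · rw [hia, hjb, hde, ← wrefl_rev h1 h2 e]
    exact wrefl_symm (fun h => h1 (Fin.rev_inj.mp h).symm) e

/-- The strong exchange property. -/
lemma exists_sublist_of_side {n : ℕ} {hn : 2 ≤ n} {ω : Wt n}
    (hω : ∀ {i j : Fin (2*n)}, i ≠ j → j ≠ i.rev → ∀ d : ℤ,
      0 < side n i j d (wone n) * side n i j d ω)
    (L : List (Wt n)) (hL : isWord n hn L) {i j : Fin (2*n)} (hij : i ≠ j) (hij' : j ≠ i.rev)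
    {d : ℤ} (h : side n i j d (wone n) * side n i j d (wmul n (wprod n L) ω) < 0) :
    ∃ L' : List (Wt n), L'.Sublist L ∧
      wmul n (wrefl n i j d) (wmul n (wprod n L) ω) = wmul n (wprod n L') ω := by
  induction L generalizing i j d with
  | nil =>
    have := hω hij hij' d
    simp only [wprod, List.foldr_nil, one_wmul] at h
    omega
  | cons s L ih =>
    have hs : s ∈ sgens n hn := hL s (by simp)
    have hL' : isWord n hn L := fun t ht => hL t (by simp [ht])
    have hcons : ∀ M, wprod n (s :: M) = wmul n s (wprod n M) := fun M => rfl
    rw [hcons, wmul_assoc] at h ⊢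
    by_cases hst : wrefl n i j d = s
    · refine ⟨L, by simp, ?_⟩
      rw [hst, ← wmul_assoc, wmul_self_of_mem_sgens hs, one_wmul]
    · have hsW := inWt_of_mem_sgens hs
      have hne : s.2⁻¹ i ≠ s.2⁻¹ j := (s.2⁻¹).injective.ne hij
      have hne' : s.2⁻¹ j ≠ (s.2⁻¹ i).rev := by
        rw [← inv_rev hsW.2]; exact (s.2⁻¹).injective.ne hij'
      have hlt : 0 < side n i j d (wone n) * side n i j d s := by
        rcases lt_trichotomy (side n i j d (wone n) * side n i j d s) 0 with h' | h' | h'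
        · exact absurd (eq_of_side_mul_side_neg hs hij' h') hst
        · rcases mul_eq_zero.mp h' with h' | h' <;> exact absurd h' (side_ne_zero hij _ _)
        · exact h'
      have key : side n i j d (wone n) =
          side n (s.2⁻¹ i) (s.2⁻¹ j) (d - s.1 i + s.1 j) s := by
        rw [← side_wmul, wmul_self_of_mem_sgens hs]
      have key2 : side n i j d s =
          side n (s.2⁻¹ i) (s.2⁻¹ j) (d - s.1 i + s.1 j) (wone n) := by
        rw [← side_wmul]; congr 1; ext <;> simp [wmul, wone]
      rw [side_wmul] at h
      obtain ⟨L', hsub, he⟩ := ih hL' hne hne' (d := d - s.1 i + s.1 j) (by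
        rw [← key2]
        by_contra hcon
        push Not at hcon
        nlinarith [mul_nonneg hlt.le hcon, mul_neg_of_neg_of_pos h
          (pow_pos (abs_pos.mpr (side_ne_zero hij d s)) 2), sq_abs (side n i j d s)])
      refine ⟨s :: L', by simpa using hsub, ?_⟩
      rw [hcons, wmul_assoc, ← he, ← wmul_assoc (wrefl n i j d), wrefl_wmul hij hij' d hsW,
        wmul_assoc]

/-- The conditions for all positive roots follow from those for the roots `x_i ∓ x_j`,
`i < j ≤ n`. -/
lemma forall_pos_roots_iff {α : Type*} [AddCommGroup α] {n : ℕ} {f : Fin (2*n) → α}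
    (hf : ∀ i j, f i + f i.rev = f j + f j.rev) (S : α → Prop) :
    (∀ i j : Fin (2*n), i < j → (j:ℕ) < n →
      S (f i - f j) ∧ S (f i + f j - (f i + f i.rev))) ↔
    ∀ i j : Fin (2*n), i < j → j ≠ i.rev → S (f i - f j) := by
  have e1 : ∀ i j, f j.rev - f i.rev = f i - f j := fun i j => by
    rw [sub_eq_sub_iff_add_eq_add, add_comm, add_comm (f i)]
    rw [add_comm (f j), add_comm (f i.rev)]
    rw [add_comm (f j.rev)]
    exact (hf i j).symm
  have e2 : ∀ i j, f i + f j - (f i + f i.rev) = f j - f i.rev := fun i j => by abel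
  constructor
  · intro h i j hij hij'
    have hij1 : (i:ℕ) < j := hij
    have hij2 : (j:ℕ) ≠ i.rev := fun h => hij' (Fin.ext h)
    have hi := Fin.val_rev i
    have hj := Fin.val_rev j
    by_cases hjn : (j:ℕ) < n
    · exact (h i j hij hjn).1
    · by_cases hin : (i:ℕ) < n
      · rcases lt_or_ge (i:ℕ) j.rev with hlt | hlt
        · have := (h i j.rev hlt (by omega)).2
          rwa [e2, e1] at this
        · have := (h j.rev i (show (j.rev : ℕ) < i by omega) hin).2
          rwa [e2, Fin.rev_rev] at this
      · have := (h j.rev i.rev (show (j.rev : ℕ) < i.rev by omega) (by omega)).1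
        rwa [e1] at this
  · intro h i j hij hjn
    have hij1 : (i:ℕ) < j := hij
    have hi := Fin.val_rev i
    refine ⟨h i j hij fun h' => ?_, ?_⟩
    · have := congrArg Fin.val h'
      omega
    · rw [e2]
      refine h j i.rev (show (j : ℕ) < i.rev by omega) fun h' => ?_
      rw [Fin.rev_inj] at h'
      omega

lemma mem_ClA_iff {n : ℕ} {x : Fin (2*n) → ℝ} :
    x ∈ ClA n ↔ inXR n x ∧
      ∀ i j : Fin (2*n), i < j → j ≠ i.rev → -1 ≤ x i - x j ∧ x i - x j ≤ 0 := by
  refine and_congr_right fun hx => ?_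
  rw [← forall_pos_roots_iff hx (fun t => -1 ≤ t ∧ t ≤ 0)]
  simp only [and_assoc]

/-- The condition that `alcPt n w` lies over the interior of the base alcove. -/
def InBase (n : ℕ) (w : Wt n) : Prop :=
  ∀ i j : Fin (2*n), i < j → j ≠ i.rev →
    -(2*n:ℤ) < alcPt n w i - alcPt n w j ∧ alcPt n w i - alcPt n w j < 0

lemma inBase_of_inOmega {n : ℕ} {w : Wt n} (hw : inOmega n w) : InBase n w := by
  intro i j hij hij'
  have hn : (0:ℝ) < 2*n := by have := i.isLt; exact_mod_cast (by omega : 0 < 2*n)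
  have hρ : (fun l : Fin (2*n) => ((l:ℕ):ℝ)/(2*n)) ∈ ClA n := by
    rw [mem_ClA_iff]
    constructor
    · intro a b
      have : ∀ a : Fin (2*n), ((a:ℕ):ℝ)/(2*n) + ((a.rev:ℕ):ℝ)/(2*n) = (2*n-1)/(2*n) := by
        intro a
        rw [← add_div, Fin.val_rev, Nat.cast_sub a.isLt]
        push_cast
        ring
      simp only [this]
    · intro a b hab _
      rw [← sub_div, le_div_iff₀ hn, div_le_iff₀ hn]
      have h1 : ((a:ℕ):ℝ) ≤ (b:ℕ) := by exact_mod_cast (show (a:ℕ) ≤ b from hab.le)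
      have h2 : ((b:ℕ):ℝ) ≤ 2*n := by exact_mod_cast b.isLt.le
      have h3 : (0:ℝ) ≤ (a:ℕ) := by positivity
      constructor <;> linarith
  have h := hw.2 ▸ Set.mem_image_of_mem (wactR n w) hρ
  rw [mem_ClA_iff] at h
  obtain ⟨h1, h2⟩ := h.2 i j hij hij'
  have e : ∀ l, wactR n w (fun l : Fin (2*n) => ((l:ℕ):ℝ)/(2*n)) l = (alcPt n w l : ℝ)/(2*n) := by
    intro l
    simp only [wactR, alcPt]
    push_cast
    rw [add_div, mul_div_cancel_left₀ _ hn.ne']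
  rw [e, e, ← sub_div] at h1 h2
  rw [le_div_iff₀ hn] at h1
  rw [div_le_iff₀ hn] at h2
  have h1' : -(2*n:ℤ) ≤ alcPt n w i - alcPt n w j := by
    have : (-1 * (2*n) : ℝ) = ((-(2*n:ℤ) : ℤ) : ℝ) := by push_cast; ring
    rw [this] at h1
    exact_mod_cast h1
  have h2' : alcPt n w i - alcPt n w j ≤ 0 := by
    rw [zero_mul] at h2
    exact_mod_cast h2
  have h3 := side_ne_zero hij.ne 0 w
  have h4 := side_ne_zero hij.ne (-1) w
  simp only [side] at h3 h4
  constructor <;> omega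

lemma InBase.side_pos {n : ℕ} {w : Wt n} (hw : InBase n w) {i j : Fin (2*n)} (hij : i ≠ j)
    (hij' : j ≠ i.rev) (d : ℤ) : 0 < side n i j d (wone n) * side n i j d w := by
  have key : ∀ (i j : Fin (2*n)), i < j → j ≠ i.rev → ∀ d : ℤ,
      0 < side n i j d (wone n) * side n i j d w := by
    intro i j hij hij' d
    obtain ⟨h1, h2⟩ := hw i j hij hij'
    have h3 : (i:ℕ) < j := hij
    have h4 := j.isLt
    simp only [side, alcPt_one]
    rcases lt_or_ge d 0 with hd | hd
    · have : (2*n:ℤ) * d ≤ -(2*n) := by nlinarith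
      apply mul_pos <;> omega
    · have : 0 ≤ (2*n:ℤ) * d := by positivity
      apply mul_pos_of_neg_of_neg <;> omega
  rcases lt_or_gt_of_ne hij with h | h
  · exact key i j h hij' d
  · have := key j i h (fun h' => hij' (by rw [h', Fin.rev_rev])) (-d)
    have e : ∀ u, side n j i (-d) u = - side n i j d u := fun u => by simp only [side]; ring
    rwa [e, e, neg_mul_neg] at this

lemma inOmega_of_inBase {n : ℕ} {w : Wt n} (hw : inWt n w) (hb : InBase n w) : inOmega n w := by
  have hr := inv_rev hw.2
  have key : ∀ i j : Fin (2*n), i < j → j ≠ i.rev →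
      (w.2⁻¹ i < w.2⁻¹ j ∧ w.1 i = w.1 j) ∨ (w.2⁻¹ j < w.2⁻¹ i ∧ w.1 i = w.1 j - 1) := by
    intro i j hij hij'
    obtain ⟨h1, h2⟩ := hb i j hij hij'
    have h3 := (w.2⁻¹ i).isLt
    have h4 := (w.2⁻¹ j).isLt
    have e : alcPt n w i - alcPt n w j =
      2*n*(w.1 i - w.1 j) + ((w.2⁻¹ i : Fin (2*n)) : ℕ) - ((w.2⁻¹ j : Fin (2*n)) : ℕ) := by
      simp only [alcPt]; ring
    rw [e] at h1 h2
    rcases lt_or_gt_of_ne ((w.2⁻¹).injective.ne hij.ne) with h | h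
    · left
      refine ⟨h, ?_⟩
      have h' : ((w.2⁻¹ i : Fin (2*n)) : ℕ) < (w.2⁻¹ j : Fin (2*n)) := h
      have a1 : w.1 i - w.1 j < 1 := by by_contra; nlinarith
      have a2 : -1 < w.1 i - w.1 j := by by_contra; nlinarith
      omega
    · right
      refine ⟨h, ?_⟩
      have h' : ((w.2⁻¹ j : Fin (2*n)) : ℕ) < (w.2⁻¹ i : Fin (2*n)) := h
      have a1 : w.1 i - w.1 j < 0 := by by_contra; nlinarith
      have a2 : -2 < w.1 i - w.1 j := by by_contra; nlinarith
      omega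
  refine ⟨hw, Set.Subset.antisymm ?_ ?_⟩
  · rintro _ ⟨x, hx, rfl⟩
    rw [mem_ClA_iff] at hx ⊢
    constructor
    · intro i j
      have h1 : (w.1 i : ℝ) + w.1 i.rev = w.1 j + w.1 j.rev := by exact_mod_cast hw.1 i j
      have h2 := hx.1 (w.2⁻¹ i) (w.2⁻¹ j)
      simp only [wactR, hr]
      linarith
    · intro i j hij hij'
      have hne : w.2⁻¹ j ≠ (w.2⁻¹ i).rev := by rw [← hr]; exact (w.2⁻¹).injective.ne hij'
      have hne' : w.2⁻¹ i ≠ (w.2⁻¹ j).rev := fun h => hne (by rw [h, Fin.rev_rev])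
      simp only [wactR]
      rcases key i j hij hij' with ⟨h, h'⟩ | ⟨h, h'⟩
      · obtain ⟨h1, h2⟩ := hx.2 _ _ h hne
        rw [h']
        constructor <;> linarith
      · obtain ⟨h1, h2⟩ := hx.2 _ _ h hne'
        rw [h']
        push_cast
        constructor <;> linarith
  · intro x hx
    rw [mem_ClA_iff] at hx
    refine ⟨fun l => x (w.2 l) - w.1 (w.2 l), ?_, by ext l; simp [wactR]⟩
    rw [mem_ClA_iff]
    constructor
    · intro i j
      have h1 : (w.1 (w.2 i) : ℝ) + w.1 (w.2 i).rev = w.1 (w.2 j) + w.1 (w.2 j).rev := by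
        exact_mod_cast hw.1 _ _
      have h2 := hx.1 (w.2 i) (w.2 j)
      simp only [hw.2 _]
      linarith
    · intro l m hlm hlm'
      have hii : ∀ l, w.2⁻¹ (w.2 l) = l := fun l => by simp
      have hne : w.2 m ≠ (w.2 l).rev := by rw [← hw.2]; exact w.2.injective.ne hlm'
      have hne' : w.2 l ≠ (w.2 m).rev := fun h => hne (by rw [h, Fin.rev_rev])
      rcases lt_or_gt_of_ne (w.2.injective.ne hlm.ne) with h | h
      · obtain ⟨h1, h2⟩ := hx.2 _ _ h hne
        have := key _ _ h hne
        simp only [hii] at this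
        have e : w.1 (w.2 l) = w.1 (w.2 m) := by
          rcases this with h | h
          · exact h.2
          · exact absurd h.1 hlm.not_gt
        simp only [e]
        constructor <;> linarith
      · obtain ⟨h1, h2⟩ := hx.2 _ _ h hne'
        have := key _ _ h hne'
        simp only [hii] at this
        have e : w.1 (w.2 m) = w.1 (w.2 l) - 1 := by
          rcases this with h | h
          · exact absurd h.1 hlm.not_gt
          · exact h.2
        simp only [e]
        push_cast
        constructor <;> linarith

/-- The squared distance of the interior points of the alcoves of `w` and `1`. -/
def sqDist (n : ℕ) (w : Wt n) : ℤ := ∑ l, (alcPt n w l - (l:ℕ))^2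

lemma sqDist_wrefl_wmul {n : ℕ} {i j : Fin (2*n)} (hij : i ≠ j) (hij' : j ≠ i.rev) (d : ℤ)
    {w : Wt n} (hw : inWt n w) :
    sqDist n (wmul n (wrefl n i j d) w) =
      sqDist n w + 4 * (side n i j d (wone n) * side n i j d w) := by
  have h1 := rev_ne i
  have h2 := rev_ne j
  have h3 : j.rev ≠ i := fun h => hij' (by rw [← h, Fin.rev_rev])
  have h4 : i.rev ≠ j.rev := fun h => hij (Fin.rev_inj.mp h)
  obtain ⟨u, hu⟩ : ∃ u, u = side n i j d w := ⟨_, rfl⟩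
  have hrr := alcPt_add_rev hw i j
  have hu' := hu
  simp only [side] at hu'
  have hP : ∀ l, alcPt n (wmul n (wrefl n i j d) w) l = alcPt n w l +
      (if l = i then -u else if l = j then u else if l = j.rev then -u
        else if l = i.rev then u else 0) := by
    intro l
    rw [alcPt_wmul, wrefl_fst, wrefl_inv_apply hij hij']
    split_ifs with h h h h
    · rw [h]; linarith
    · rw [h]; linarith
    · rw [h]; linarith
    · rw [h]; linarith
    · ring
  have hterm : ∀ l, (alcPt n (wmul n (wrefl n i j d) w) l - (l:ℕ))^2 =
      (alcPt n w l - (l:ℕ))^2 + ((if l = i then u^2 - 2*u*(alcPt n w l - (l:ℕ)) else 0)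
        + (if l = j then u^2 + 2*u*(alcPt n w l - (l:ℕ)) else 0)
        + (if l = j.rev then u^2 - 2*u*(alcPt n w l - (l:ℕ)) else 0)
        + (if l = i.rev then u^2 + 2*u*(alcPt n w l - (l:ℕ)) else 0)) := by
    intro l
    rw [hP]
    by_cases e1 : l = i
    · subst e1
      simp only [if_true, if_neg hij, if_neg h3.symm, if_neg h1.symm]; ring
    by_cases e2 : l = j
    · subst e2
      simp only [if_true, if_neg hij.symm, if_neg h2.symm, if_neg hij']; ring
    by_cases e3 : l = j.rev
    · rw [e3]
      simp only [if_true, if_neg h3, if_neg h2, if_neg h4.symm]; ring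
    by_cases e4 : l = i.rev
    · rw [e4]
      simp only [if_true, if_neg h1, if_neg hij'.symm, if_neg h4]; ring
    simp only [if_neg e1, if_neg e2, if_neg e3, if_neg e4]; ring
  simp only [sqDist, hterm, Finset.sum_add_distrib, Finset.sum_ite_eq', Finset.mem_univ, if_true]
  rw [← hu]
  simp only [side, alcPt_one, Fin.val_rev, Nat.cast_sub i.isLt, Nat.cast_sub j.isLt]
  push_cast
  have hd : alcPt n w i.rev = alcPt n w j + alcPt n w j.rev - alcPt n w i := by linarith
  have hi : alcPt n w i = u + alcPt n w j + 2*n*d := by linarith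
  rw [hd, hi]
  ring

lemma sqDist_nonneg (n : ℕ) (w : Wt n) : 0 ≤ sqDist n w :=
  Finset.sum_nonneg fun _ _ => sq_nonneg _

/-- An alcove on the same side as the base alcove of all walls of the base alcove is the base
alcove; for `n = 2`, one of the walls is missing from `sgens`. -/
lemma inBase_of_walls {n : ℕ} (hn : 2 ≤ n) {w : Wt n} (hw : inWt n w)
    (h2 : n = 2 → ∀ i j : Fin (2*n), (i:ℕ) = 0 → (j:ℕ) = 1 → alcPt n w j - alcPt n w i < 4)
    (hs : ∀ (i j : Fin (2*n)) (d : ℤ), i ≠ j → j ≠ i.rev → wrefl n i j d ∈ sgens n hn →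
      0 < side n i j d (wone n) * side n i j d w) : InBase n w := by
  obtain ⟨x, hx⟩ : ∃ x : ℕ → ℤ, ∀ l : Fin (2*n), alcPt n w l = x l :=
    ⟨fun m => if h : m < 2*n then alcPt n w ⟨m, h⟩ else 0, fun l => by simp⟩
  have hrev : ∀ a b a' b' : ℕ, a < 2*n → b < 2*n → a + a' + 1 = 2*n → b + b' + 1 = 2*n →
      x a + x a' = x b + x b' := by
    intro a b a' b' ha hb ha' hb'
    have := alcPt_add_rev hw ⟨a, ha⟩ ⟨b, hb⟩
    simp only [hx, Fin.val_rev] at this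
    rwa [show 2*n - (a+1) = a' by omega, show 2*n - (b+1) = b' by omega] at this
  have hne : ∀ {i j : Fin (2*n)}, (j:ℕ) ≠ 2*n - (i + 1) → j ≠ i.rev := by
    intro i j h h'
    rw [h', Fin.val_rev] at h
    exact h rfl
  have hstep : ∀ a : ℕ, a + 1 < n → x a < x (a+1) := by
    intro a ha
    have hv : ((csucc n ⟨a, by omega⟩ : Fin (2*n)) : ℕ) = a + 1 :=
      Nat.mod_eq_of_lt (show a + 1 < 2*n by omega)
    have := hs ⟨a, by omega⟩ (csucc n ⟨a, by omega⟩) 0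
      (fun h => by have := congrArg Fin.val h; rw [hv] at this; simp at this)
      (hne (by rw [hv]; show a + 1 ≠ 2*n - (a+1); omega)) (Or.inl ⟨⟨a, by omega⟩, ha, rfl⟩)
    simp only [side, alcPt_one, hx, hv] at this
    rcases mul_pos_iff.mp this with h | h <;> omega
  have hmid : x (n-2) < x n := by
    have := hs ⟨n-2, by omega⟩ ⟨n, by omega⟩ 0
      (fun h => by have := congrArg Fin.val h; simp only at this; omega)
      (hne (by show n ≠ 2*n - (n-2+1); omega)) (Or.inr (Or.inl rfl))
    simp only [side, alcPt_one, hx] at this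
    rcases mul_pos_iff.mp this with h | h <;> omega
  have haff : x 0 - x (2*n-2) > -(2*n) := by
    have := hs ⟨0, by omega⟩ ⟨2*n-2, by omega⟩ (-1)
      (fun h => by have := congrArg Fin.val h; simp only at this; omega)
      (hne (by show 2*n-2 ≠ 2*n - (0+1); omega)) (Or.inr (Or.inr rfl))
    simp only [side, alcPt_one, hx] at this
    rcases mul_pos_iff.mp this with h | h <;> omega
  have hmono : ∀ b, b < n → ∀ a, a < b → x a < x b := by
    intro b
    induction b with
    | zero => intro _ a ha; omega
    | succ b ih =>
      intro hb a ha
      have h1 := hstep b hb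
      rcases Nat.lt_succ_iff_lt_or_eq.mp ha with h | rfl
      · exact (ih (by omega) a h).trans h1
      · exact h1
  have hmono' : ∀ b, b < n → ∀ a, a ≤ b → x a ≤ x b := fun b hb a hab => by
    rcases hab.lt_or_eq with h | rfl
    · exact (hmono b hb a h).le
    · exact le_rfl
  have hC1 := hrev 0 n (2*n-1) (n-1) (by omega) (by omega) (by omega) (by omega)
  have hC2 := hrev 0 1 (2*n-1) (2*n-2) (by omega) (by omega) (by omega) (by omega)
  have hwide : x (n-1) - x 0 < 2*n := by
    rcases eq_or_lt_of_le hn with h | h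
    · subst h
      have := h2 rfl ⟨0, by omega⟩ ⟨1, by omega⟩ rfl rfl
      simp only [hx] at this
      simpa using this
    · have := hmono' (n-2) (by omega) 1 (by omega)
      omega
  refine (forall_pos_roots_iff (alcPt_add_rev hw) (fun t => -(2*n:ℤ) < t ∧ t < 0)).mp ?_
  intro i j hij hjn
  have hij' : (i:ℕ) < j := hij
  have hC := hrev 0 i (2*n-1) (2*n - (i+1)) (by omega) (by omega) (by omega) (by omega)
  simp only [hx, Fin.val_rev]
  have m1 := hmono j hjn i hij
  have m2 := hmono' (n-1) (by omega) j (by omega)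
  have m3 := hmono' i (by omega) 0 (by omega)
  have m4 := hmono' (n-2) (by omega) i (by omega)
  have m5 := hmono' j hjn 1 (by omega)
  refine ⟨⟨by omega, by omega⟩, by omega, by omega⟩

/-- Every element of `W̃` whose alcove lies in the orbit of the base alcove under the group
generated by `sgens` has a word. -/
lemma exists_word {n : ℕ} (hn : 2 ≤ n) {w : Wt n} (hw : inWt n w)
    (h2 : n = 2 → ∀ i j : Fin (2*n), (i:ℕ) = 0 → (j:ℕ) = 1 →
      alcPt n w j - alcPt n w i < 4 ∧ alcPt n w i - alcPt n w j < 4) :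
    ∃ L ω, isWord n hn L ∧ inOmega n ω ∧ w = wmul n (wprod n L) ω := by
  induction hN : (sqDist n w).toNat using Nat.strong_induction_on generalizing w with
  | _ N ih =>
    by_cases hb : ∀ (i j : Fin (2*n)) (d : ℤ), i ≠ j → j ≠ i.rev → wrefl n i j d ∈ sgens n hn →
      0 < side n i j d (wone n) * side n i j d w
    · refine ⟨[], w, fun s hs => by simp at hs, inOmega_of_inBase hw
        (inBase_of_walls hn hw (fun h i j hi hj => (h2 h i j hi hj).1) hb), ?_⟩
      simp [wprod, one_wmul]
    · push Not at hb
      obtain ⟨i, j, d, hij, hij', hs, hle⟩ := hb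
      have hlt : side n i j d (wone n) * side n i j d w < 0 :=
        lt_of_le_of_ne hle (mul_ne_zero (side_ne_zero hij _ _) (side_ne_zero hij _ _))
      have hsq := sqDist_wrefl_wmul hij hij' d hw
      have hnn := sqDist_nonneg n (wmul n (wrefl n i j d) w)
      obtain ⟨L, ω, hL, hω, he⟩ := ih (sqDist n (wmul n (wrefl n i j d) w)).toNat (by omega)
        (inWt_wmul (inWt_wrefl hij hij' d) hw) (by
          rintro rfl i' j' hi' hj'
          obtain ⟨h3, h4⟩ := h2 rfl i' j' hi' hj'
          obtain ⟨a, b, e, ha, hb, hs', hc⟩ := exists_params_of_mem_sgens hs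
          have hrr := alcPt_add_rev hw i' j'
          rw [hs', alcPt_wmul, alcPt_wmul, wrefl_inv_apply ha hb, wrefl_inv_apply ha hb,
            wrefl_fst, wrefl_fst]
          rcases hc with ⟨c1, c2, rfl⟩ | ⟨c1, c2, rfl⟩ | ⟨c1, c2, rfl⟩
          · have e1 : i' = a := Fin.ext (by omega)
            have e2 : j' = b := Fin.ext (by omega)
            subst e1 e2
            simp only [if_true, if_neg ha.symm]
            constructor <;> omega
          all_goals
            have e1 : i' = a := Fin.ext (by omega)
            have e2 : j' = b.rev := Fin.ext (by rw [Fin.val_rev]; omega)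
            subst e1
            rw [e2, Fin.rev_rev] at hrr
            rw [e2] at h3 h4 ⊢
            have e3 : b.rev ≠ i' := fun h => hb (by rw [← h, Fin.rev_rev])
            simp only [if_true, if_neg (rev_ne b), if_neg e3]
            constructor <;> omega) rfl
      refine ⟨wrefl n i j d :: L, ω, ?_, hω, ?_⟩
      · intro s hs'
        rcases List.mem_cons.mp hs' with rfl | h
        · exact hs
        · exact hL s h
      · show w = wmul n (wmul n (wrefl n i j d) (wprod n L)) ω
        rw [wmul_assoc, ← he, ← wmul_assoc, wrefl_wmul_self hij hij', one_wmul]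

/-- A reflection moving the alcove of `w` across a hyperplane away from the base alcove
goes up in the Bruhat order. -/
lemma wlt_wrefl_wmul {n : ℕ} (hn : 2 ≤ n) {w : Wt n} (hw : inWt n w) {i j : Fin (2*n)} {d : ℤ}
    (hij : i ≠ j) (hij' : j ≠ i.rev)
    (h : 0 < side n i j d (wone n) * side n i j d w)
    (h2 : n = 2 → ∀ i' j' : Fin (2*n), (i':ℕ) = 0 → (j':ℕ) = 1 →
      alcPt n (wmul n (wrefl n i j d) w) j' - alcPt n (wmul n (wrefl n i j d) w) i' < 4 ∧
      alcPt n (wmul n (wrefl n i j d) w) i' - alcPt n (wmul n (wrefl n i j d) w) j' < 4) :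
    wlt n hn w (wmul n (wrefl n i j d) w) := by
  have hne : {m | ∃ L ω, isWord n hn L ∧ L.length = m ∧ inOmega n ω ∧
      wmul n (wrefl n i j d) w = wmul n (wprod n L) ω}.Nonempty := by
    obtain ⟨L, ω, hL, hω, he⟩ := exists_word hn (inWt_wmul (inWt_wrefl hij hij' d) hw) h2
    exact ⟨L.length, L, ω, hL, rfl, hω, he⟩
  obtain ⟨L, ω, hL, hlen, hω, he⟩ := Nat.sInf_mem hne
  have hside := side_wrefl_wmul hij hij' d w
  have hself : wmul n (wrefl n i j d) (wmul n (wrefl n i j d) w) = w := by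
    rw [← wmul_assoc, wrefl_wmul_self hij hij', one_wmul]
  obtain ⟨L', hsub, he'⟩ := exists_sublist_of_side
    (fun hij hij' d => (inBase_of_inOmega hω).side_pos hij hij' d) L hL hij hij' (d := d)
    (by rw [← he, hside]; linarith [mul_neg (side n i j d (wone n)) (side n i j d w)])
  rw [← he, hself] at he'
  refine ⟨⟨L, ω, hL, hω, he, hlen, L', hsub, he'⟩, fun heq => ?_⟩
  rw [← heq] at hside
  have := side_ne_zero hij d w
  omega

lemma permAct_mul {n : ℕ} (σ τ : Equiv.Perm (Fin (2*n))) (μ : Fin (2*n) → ℤ) :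
    permAct n (σ * τ) μ = permAct n σ (permAct n τ μ) := by
  funext l; simp [permAct]

lemma inSh_mul {n : ℕ} {σ τ : Equiv.Perm (Fin (2*n))} (h : inSh n σ) (h' : inSh n τ) :
    inSh n (σ * τ) := fun i => by simp [h' i, h (τ i)]

lemma inSh_inv {n : ℕ} {σ : Equiv.Perm (Fin (2*n))} (h : inSh n σ) : inSh n σ⁻¹ :=
  fun i => inv_rev h i

lemma inSh_swap_rev {n : ℕ} (c : Fin (2*n)) : inSh n (Equiv.swap c c.rev) := by
  intro l
  have h := rev_ne c
  have e1 : l.rev = c ↔ l = c.rev := Fin.rev_eq_iff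
  simp only [Equiv.swap_apply_def, Fin.rev_inj, e1]
  grind [Fin.rev_rev]

/-- Membership in the `W°`-orbit of `μ`. -/
def Orb (n : ℕ) (μ u : Fin (2*n) → ℤ) : Prop := ∃ σ, inW0 n σ ∧ u = permAct n σ μ

lemma Orb.permAct {n : ℕ} {μ u : Fin (2*n) → ℤ} (h : Orb n μ u) {τ : Equiv.Perm (Fin (2*n))}
    (hτ : inW0 n τ) : Orb n μ (permAct n τ u) := by
  obtain ⟨σ, hσ, rfl⟩ := h
  exact ⟨τ * σ, ⟨inSh_mul hτ.1 hσ.1, by rw [map_mul, hτ.2, hσ.2, one_mul]⟩, (permAct_mul ..).symm⟩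

lemma inW0_wrefl {n : ℕ} {i j : Fin (2*n)} (hij : i ≠ j) (hij' : j ≠ i.rev) :
    inW0 n (Equiv.swap i j * Equiv.swap i.rev j.rev) := by
  refine ⟨(inWt_wrefl hij hij' 0).2, ?_⟩
  rw [map_mul, Equiv.Perm.sign_swap hij,
    Equiv.Perm.sign_swap (fun h => hij (Fin.rev_inj.mp h))]
  simp

/-- A vector with entries in `{0,1}` that is totally isotropic. -/
def IsoVec (n : ℕ) (u : Fin (2*n) → ℤ) : Prop := (∀ j, u j = 0 ∨ u j = 1) ∧ TotIso n u

/-- Up to the exchange of one pair of opposite entries, all isotropic `{0,1}`-vectors are in a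
single `W°`-orbit. -/
lemma orb_or_orb_swap {n : ℕ} {μ u : Fin (2*n) → ℤ} (hμ : IsoVec n μ) (hu : IsoVec n u)
    (c : Fin (2*n)) : Orb n μ u ∨ Orb n μ (permAct n (Equiv.swap c c.rev) u) := by
  have hflip : ∀ j, u j.rev = μ j.rev ↔ u j = μ j := by
    intro j
    have h1 := hμ.2 j
    have h2 := hu.2 j
    omega
  have hinv : Function.Involutive (fun j => if u j = μ j then j else j.rev) := by
    intro j
    by_cases h : u j = μ j
    · simp [h]
    · simp [h, hflip]
  obtain ⟨σ, hσ⟩ : ∃ σ : Equiv.Perm (Fin (2*n)), σ = hinv.toPerm := ⟨_, rfl⟩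
  have hσ1 : ∀ j, σ j = if u j = μ j then j else j.rev := fun j => by rw [hσ]; rfl
  have hσ2 : σ⁻¹ = σ := by rw [hσ]; exact hinv.toPerm_symm
  have hSh : inSh n σ := by
    intro j
    simp only [hσ1, hflip]
    split_ifs <;> rfl
  have hact : u = permAct n σ μ := by
    funext j
    simp only [permAct, hσ2, hσ1]
    have h1 := hμ.2 j
    have h2 := hu.2 j
    have h3 := hμ.1 j
    have h4 := hu.1 j
    split_ifs <;> omega
  rcases Int.units_eq_one_or (Equiv.Perm.sign σ) with h | h
  · exact Or.inl ⟨σ, ⟨hSh, h⟩, hact⟩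
  · refine Or.inr ⟨Equiv.swap c c.rev * σ, ⟨inSh_mul (inSh_swap_rev c) hSh, ?_⟩, ?_⟩
    · rw [map_mul, h, Equiv.Perm.sign_swap (rev_ne c).symm]; simp
    · rw [permAct_mul, ← hact]

/-- The stabilizer in `S^h` of an isotropic vector consists of even permutations. -/
lemma sign_eq_one_of_permAct_eq {n : ℕ} {μ : Fin (2*n) → ℤ} (hμ : IsoVec n μ)
    {ρ : Equiv.Perm (Fin (2*n))} (hρ : inSh n ρ) (h : permAct n ρ μ = μ) :
    Equiv.Perm.sign ρ = 1 := by
  have hinv : ∀ j, μ (ρ j) = μ j := fun j => by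
    have := congrFun h (ρ j)
    simpa [permAct] using this.symm
  have hS : ∀ j, μ j = 1 ↔ μ (ρ j) = 1 := fun j => by rw [hinv]
  obtain ⟨α, hα⟩ : ∃ α : Equiv.Perm (Fin (2*n)),
    α = Equiv.Perm.ofSubtype (ρ.subtypePerm (p := fun j => μ j = 1) fun j => (hS j).symm) :=
    ⟨_, rfl⟩
  have hα1 : ∀ j, μ j = 1 → α j = ρ j := fun j hj => by
    rw [hα]; exact Equiv.Perm.ofSubtype_apply_of_mem (ρ.subtypePerm _) hj
  have hα2 : ∀ j, μ j ≠ 1 → α j = j := fun j hj => by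
    rw [hα]; exact Equiv.Perm.ofSubtype_apply_of_not_mem (ρ.subtypePerm _) hj
  have hrev : ∀ j, μ j.rev = 1 ↔ μ j ≠ 1 := fun j => by
    have h1 := hμ.2 j
    have h2 := hμ.1 j
    omega
  have hdec : ρ = α * (Fin.revPerm * α * Fin.revPerm) := by
    ext j
    simp only [Equiv.Perm.mul_apply, Fin.revPerm_apply]
    by_cases hj : μ j = 1
    · have h1 : μ j.rev ≠ 1 := fun h => ((hrev j).mp h) hj
      rw [hα2 _ h1, Fin.rev_rev, hα1 _ hj]
    · have h1 : μ j.rev = 1 := (hrev j).mpr hj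
      have h2 : μ (ρ j) ≠ 1 := by rwa [hinv]
      rw [hα1 _ h1, hρ, Fin.rev_rev, hα2 _ h2]
  rw [hdec]
  simp only [map_mul]
  rw [mul_right_comm (Equiv.Perm.sign Fin.revPerm), Int.units_mul_self, one_mul,
    Int.units_mul_self]

lemma not_orb_swap {n : ℕ} {μ u : Fin (2*n) → ℤ} (hμ : IsoVec n μ) (hu : Orb n μ u)
    (c : Fin (2*n)) : ¬ Orb n μ (permAct n (Equiv.swap c c.rev) u) := by
  rintro ⟨τ, hτ, h⟩
  obtain ⟨σ, hσ, rfl⟩ := hu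
  rw [← permAct_mul] at h
  have hst : permAct n (τ⁻¹ * (Equiv.swap c c.rev * σ)) μ = μ := by
    rw [permAct_mul, h, ← permAct_mul]
    funext l; simp [permAct]
  have := sign_eq_one_of_permAct_eq hμ
    (inSh_mul (inSh_inv hτ.1) (inSh_mul (inSh_swap_rev c) hσ.1)) hst
  rw [map_mul, map_mul, Equiv.Perm.sign_inv, hτ.2, hσ.2, Equiv.Perm.sign_swap (rev_ne c).symm]
    at this
  exact absurd this (by decide)

lemma isoVec_mu1 (n : ℕ) : IsoVec n (mu1 n) := by
  refine ⟨fun j => ?_, fun j => ?_⟩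
  · simp only [mu1]; split_ifs <;> simp
  · have := j.isLt
    simp only [mu1, Fin.val_rev]; split_ifs <;> omega

lemma isoVec_mu2 {n : ℕ} (hn : 2 ≤ n) : IsoVec n (mu2 n) := by
  refine ⟨fun j => ?_, fun j => ?_⟩
  · simp only [mu2]; split_ifs <;> simp
  · have := j.isLt
    simp only [mu2, Fin.val_rev]; split_ifs <;> omega

lemma muk_apply {n : ℕ} (w : Wt n) (k : ℕ) (j : Fin (2*n)) :
    muk n w k j = w.1 j - (if ((w.2⁻¹ j : Fin (2*n)) : ℕ) < k then 1 else 0)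
      + (if (j:ℕ) < k then 1 else 0) := by
  simp only [muk, valc, wact, om]
  split_ifs <;> ring

/-- A reformulation of `GL`-permissibility in terms of the two components of `w`. -/
def GLdata (n : ℕ) (w : Wt n) : Prop :=
  ∀ j, (w.1 j = 0 ∨ w.1 j = 1) ∧ w.1 j + w.1 j.rev = 1 ∧
    (((w.2⁻¹ j : Fin (2*n)) : ℕ) < j → w.1 j = 1) ∧
    ((j:ℕ) < (w.2⁻¹ j : Fin (2*n)) → w.1 j = 0)

lemma GLdata.muk_mem {n : ℕ} {w : Wt n} (hG : GLdata n w) (k : ℕ) (j : Fin (2*n)) :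
    muk n w k j = 0 ∨ muk n w k j = 1 := by
  obtain ⟨h1, -, h3, h4⟩ := hG j
  rw [muk_apply]
  split_ifs <;> omega

lemma gLperm_iff {n : ℕ} {w : Wt n} (hw : inWt n w) : GLperm n w ↔ GLdata n w := by
  have hv : ∀ j, valc n w 0 j = w.1 j := fun j => by simp [valc, wact, om]
  have hm : ∀ k j, (om n k j ≤ valc n w k j ∧ valc n w k j ≤ om n k j + 1) ↔
      (0 ≤ muk n w k j ∧ muk n w k j ≤ 1) := fun k j => by
    simp only [muk]; omega
  have hsum : (∑ j, (w.1 j + w.1 j.rev)) = 2 * ∑ j, w.1 j := by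
    have : ∑ j : Fin (2*n), w.1 j.rev = ∑ j, w.1 j := Equiv.sum_comp Fin.revPerm w.1
    rw [Finset.sum_add_distrib, this, ← two_mul]
  simp only [GLperm, hv, hm]
  constructor
  · rintro ⟨h0, h⟩ j
    have hj := j.isLt
    have hc : ∀ l, w.1 l + w.1 l.rev = w.1 j + w.1 j.rev := fun l => hw.1 l j
    simp only [hc, Finset.sum_const, Finset.card_univ, Fintype.card_fin, nsmul_eq_mul, h0] at hsum
    have hc1 : w.1 j + w.1 j.rev = 1 := by
      have hpos : (2*n:ℤ) ≠ 0 := by omega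
      apply mul_left_cancel₀ hpos
      push_cast at hsum
      linarith
    have h1 := h 0 (by omega) j
    simp only [muk_apply] at h1
    simp only [Nat.not_lt_zero, if_false] at h1
    refine ⟨by omega, hc1, fun hlt => ?_, fun hlt => ?_⟩
    · have h2 := h ((w.2⁻¹ j : Fin (2*n)) + 1) (by omega) j
      rw [muk_apply, if_pos (by omega), if_neg (by omega)] at h2
      omega
    · have h2 := h (j + 1) (by have := (w.2⁻¹ j).isLt; omega) j
      rw [muk_apply, if_neg (by omega), if_pos (by omega)] at h2
      omega
  · intro hG
    refine ⟨?_, fun k _ j => ?_⟩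
    · simp only [fun j => (hG j).2.1, Finset.sum_const, Finset.card_univ, Fintype.card_fin,
        nsmul_eq_mul] at hsum
      push_cast at hsum
      linarith
    · rcases hG.muk_mem k j with h | h <;> omega

lemma muk_rev {n : ℕ} {w : Wt n} (hw : inWt n w) (hG : GLdata n w) {k : ℕ} (hk : k ≤ 2*n)
    (j : Fin (2*n)) : muk n w k j.rev = 1 - muk n w (2*n - k) j := by
  have h1 := (hG j).2.1
  have h2 := j.isLt
  have h3 := (w.2⁻¹ j).isLt
  simp only [muk_apply, inv_rev hw.2, Fin.val_rev]
  split_ifs <;> omega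

lemma SpinPerm.orb {n : ℕ} {w : Wt n} {μ : Fin (2*n) → ℤ} (hw : inWt n w) (hG : GLdata n w)
    (h : SpinPerm n μ w) {k : ℕ} (hk : k ≤ 2*n) (ht : TotIso n (muk n w k)) :
    Orb n μ (muk n w k) := by
  by_cases hkn : k ≤ n
  · exact h.2 k hkn ht
  · have e : muk n w (2*n - k) = muk n w k := by
      funext j
      have h1 := ht j
      rw [muk_rev hw hG hk] at h1
      omega
    have := h.2 (2*n - k) (by omega)
    rw [e] at this
    exact this ht

/-- The reflection exchanging the slots `a` and `b` for which `a` is, cyclically, to be raised. -/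
def upRefl (n : ℕ) (a b : Fin (2*n)) : Wt n :=
  if a < b then wrefl n a b 0 else wrefl n b a (-1)

lemma upRefl_values {n : ℕ} {a b : Fin (2*n)} (hab : a ≠ b) (hab' : b ≠ a.rev) (w : Wt n) :
    (((wmul n (upRefl n a b) w).2⁻¹ a = w.2⁻¹ b ∧
        (wmul n (upRefl n a b) w).1 a = w.1 b + if b < a then 1 else 0) ∧
      ((wmul n (upRefl n a b) w).2⁻¹ b = w.2⁻¹ a ∧
        (wmul n (upRefl n a b) w).1 b = w.1 a - if b < a then 1 else 0)) ∧
    (((wmul n (upRefl n a b) w).2⁻¹ b.rev = w.2⁻¹ a.rev ∧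
        (wmul n (upRefl n a b) w).1 b.rev = w.1 a.rev + if b < a then 1 else 0) ∧
      ((wmul n (upRefl n a b) w).2⁻¹ a.rev = w.2⁻¹ b.rev ∧
        (wmul n (upRefl n a b) w).1 a.rev = w.1 b.rev - if b < a then 1 else 0)) ∧
    ∀ l, l ≠ a → l ≠ b → l ≠ b.rev → l ≠ a.rev →
      (wmul n (upRefl n a b) w).2⁻¹ l = w.2⁻¹ l ∧ (wmul n (upRefl n a b) w).1 l = w.1 l := by
  have h1 := rev_ne a
  have h2 := rev_ne b
  have h3 : b.rev ≠ a := fun h => hab' (by rw [← h, Fin.rev_rev])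
  have h4 : a.rev ≠ b.rev := fun h => hab (Fin.rev_inj.mp h)
  simp only [wmul, mul_inv_rev, Equiv.Perm.mul_apply]
  rcases lt_or_gt_of_ne hab with h | h
  · simp only [upRefl, if_pos h, wrefl_inv_apply hab hab', wrefl_fst, if_neg h.not_gt, if_true,
      if_neg hab.symm, if_neg h3, if_neg h2, if_neg h1, if_neg h4, if_neg hab'.symm]
    refine ⟨⟨⟨trivial, by ring⟩, trivial, by ring⟩,
      ⟨⟨trivial, by ring⟩, trivial, by ring⟩, ?_⟩
    intro l l1 l2 l3 l4
    simp only [if_neg l1, if_neg l2, if_neg l3, if_neg l4, zero_add, and_self]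
  · simp only [upRefl, if_neg h.not_gt, wrefl_inv_apply hab.symm h3.symm, wrefl_fst, if_pos h,
      if_true, if_neg hab, if_neg h3, if_neg h2, if_neg h1, if_neg h4.symm, if_neg hab'.symm]
    refine ⟨⟨⟨trivial, by ring⟩, trivial, by ring⟩,
      ⟨⟨trivial, by ring⟩, trivial, by ring⟩, ?_⟩
    intro l l1 l2 l3 l4
    simp only [if_neg l1, if_neg l2, if_neg l3, if_neg l4, zero_add, and_self]

lemma inWt_upRefl {n : ℕ} {a b : Fin (2*n)} (hab : a ≠ b) (hab' : b ≠ a.rev) :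
    inWt n (upRefl n a b) := by
  have h3 : a ≠ b.rev := fun h => hab' (by rw [h, Fin.rev_rev])
  unfold upRefl
  split_ifs
  · exact inWt_wrefl hab hab' 0
  · exact inWt_wrefl hab.symm h3 (-1)

/-- The cyclic interval `(a,b]` in `ℤ/2nℤ`, on representatives in `{0,…,2n}`. -/
def Arc (a b k : ℕ) : Prop := (a < b ∧ a < k ∧ k ≤ b) ∨ (b < a ∧ (a < k ∨ k ≤ b))

/-- The effect of `upRefl` on the vectors `μ_k`. -/
lemma muk_upRefl {n : ℕ} {a b : Fin (2*n)} (hab : a ≠ b) (hab' : b ≠ a.rev) (w : Wt n) {k : ℕ}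
    (hk : k ≤ 2*n) :
    (Arc a b k → muk n (wmul n (upRefl n a b) w) k a = muk n w k b + 1 ∧
      muk n (wmul n (upRefl n a b) w) k b = muk n w k a - 1) ∧
    (¬ Arc a b k → muk n (wmul n (upRefl n a b) w) k a = muk n w k b ∧
      muk n (wmul n (upRefl n a b) w) k b = muk n w k a) ∧
    (Arc a b (2*n - k) → muk n (wmul n (upRefl n a b) w) k b.rev = muk n w k a.rev + 1 ∧
      muk n (wmul n (upRefl n a b) w) k a.rev = muk n w k b.rev - 1) ∧
    (¬ Arc a b (2*n - k) → muk n (wmul n (upRefl n a b) w) k b.rev = muk n w k a.rev ∧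
      muk n (wmul n (upRefl n a b) w) k a.rev = muk n w k b.rev) ∧
    ∀ l, l ≠ a → l ≠ b → l ≠ b.rev → l ≠ a.rev →
      muk n (wmul n (upRefl n a b) w) k l = muk n w k l := by
  obtain ⟨⟨⟨a1, a2⟩, b1, b2⟩, ⟨⟨c1, c2⟩, d1, d2⟩, hl⟩ := upRefl_values hab hab' w
  have ha := a.isLt
  have hb := b.isLt
  have hne : (a:ℕ) ≠ b := fun h => hab (Fin.ext h)
  simp only [muk_apply, a1, a2, b1, b2, c1, c2, d1, d2, Fin.val_rev, Fin.lt_def, Arc]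
  refine ⟨?_, ?_, ?_, ?_, ?_⟩
  · intro h; constructor <;> split_ifs <;> omega
  · intro h; constructor <;> split_ifs <;> omega
  · intro h; constructor <;> split_ifs <;> omega
  · intro h; constructor <;> split_ifs <;> omega
  · intro l l1 l2 l3 l4
    simp only [hl l l1 l2 l3 l4]

/-- The length of the cyclic interval from `p` to `m` in `ℤ/2nℤ`. -/
def cycLen (n p m : ℕ) : ℕ := if p ≤ m then m - p else m + 2*n - p

/-- The slot `b` is proper, and its interval is as short as possible. -/
def IsShortest (n : ℕ) (w : Wt n) (b : Fin (2*n)) : Prop :=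
  w.2⁻¹ b ≠ b ∧ ∀ m, w.2⁻¹ m ≠ m →
    cycLen n (w.2⁻¹ b : Fin (2*n)) b ≤ cycLen n (w.2⁻¹ m : Fin (2*n)) m

/-- The slot `a ≠ b*` is proper and lies in the interval of `b`. -/
def IsCand (n : ℕ) (w : Wt n) (b a : Fin (2*n)) : Prop :=
  w.2⁻¹ a ≠ a ∧ a ≠ b.rev ∧ ((w.2⁻¹ b < b ∧ w.2⁻¹ b ≤ a ∧ a < b) ∨
    (b < w.2⁻¹ b ∧ (w.2⁻¹ b ≤ a ∨ a < b)))

lemma IsCand.ne {n : ℕ} {w : Wt n} {a b : Fin (2*n)} (ha : IsCand n w b a) : a ≠ b := by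
  obtain ⟨-, -, h⟩ := ha
  rintro rfl
  simp only [Fin.lt_def, Fin.le_def] at h
  omega

lemma IsCand.ne_rev {n : ℕ} {w : Wt n} {a b : Fin (2*n)} (ha : IsCand n w b a) : b ≠ a.rev :=
  fun h => ha.2.1 (by rw [h, Fin.rev_rev])

lemma exists_isShortest {n : ℕ} {w : Wt n} (h : w.2 ≠ 1) : ∃ b, IsShortest n w b := by
  classical
  have hne : (univ.filter fun m => w.2⁻¹ m ≠ m).Nonempty := by
    by_contra hcon
    rw [Finset.not_nonempty_iff_eq_empty, Finset.filter_eq_empty_iff] at hcon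
    apply h
    rw [← inv_inj, inv_one]
    ext m
    simpa using congrArg Fin.val (not_not.mp (hcon (Finset.mem_univ m)))
  obtain ⟨b, hb, hmin⟩ := Finset.exists_min_image _
    (fun m => cycLen n (w.2⁻¹ m : Fin (2*n)) m) hne
  exact ⟨b, (Finset.mem_filter.mp hb).2, fun m hm =>
    hmin m (Finset.mem_filter.mpr ⟨Finset.mem_univ _, hm⟩)⟩

section

variable {n : ℕ} {w : Wt n} {a b : Fin (2*n)}

/-- The numerical content of minimality. -/
lemma IsShortest.bounds (hb : IsShortest n w b) (ha : IsCand n w b a) :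
    ((w.2⁻¹ a : Fin (2*n)) : ℕ) ≠ (w.2⁻¹ b : Fin (2*n)) ∧
    ((w.2⁻¹ b : Fin (2*n)) : ℕ) ≠ b ∧ ((w.2⁻¹ a : Fin (2*n)) : ℕ) ≠ a ∧ (a:ℕ) ≠ b ∧
    cycLen n (w.2⁻¹ b : Fin (2*n)) b ≤ cycLen n (w.2⁻¹ a : Fin (2*n)) a := by
  refine ⟨fun h => ha.ne ((w.2⁻¹).injective (Fin.ext h)), fun h => hb.1 (Fin.ext h),
    fun h => ha.1 (Fin.ext h), fun h => ha.ne (Fin.ext h), hb.2 a ha.1⟩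

/-- By passing to the slot `a*`, minimality also bounds the interval of `a` from above. -/
lemma IsShortest.add_le (hw : inWt n w) (hb : IsShortest n w b) (ha : w.2⁻¹ a ≠ a) :
    cycLen n (w.2⁻¹ b : Fin (2*n)) b + cycLen n (w.2⁻¹ a : Fin (2*n)) a ≤ 2*n := by
  have h := hb.2 a.rev (by
    rw [inv_rev hw.2]; exact fun h => ha (Fin.rev_inj.mp h))
  have hne : ((w.2⁻¹ a : Fin (2*n)) : ℕ) ≠ a := fun h => ha (Fin.ext h)
  have hta := (w.2⁻¹ a).isLt
  have hal := a.isLt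
  rw [inv_rev hw.2, Fin.val_rev, Fin.val_rev] at h
  have h2 : cycLen n (2*n - ((w.2⁻¹ a : Fin (2*n)) + 1)) (2*n - (a+1)) +
      cycLen n (w.2⁻¹ a : Fin (2*n)) a = 2*n := by
    simp only [cycLen]; split_ifs <;> omega
  omega

lemma GLdata.upRefl (hw : inWt n w) (hG : GLdata n w) (hb : IsShortest n w b)
    (ha : IsCand n w b a) : GLdata n (wmul n (upRefl n a b) w) := by
  obtain ⟨⟨⟨a1, a2⟩, b1, b2⟩, ⟨⟨c1, c2⟩, d1, d2⟩, hl⟩ := upRefl_values ha.ne ha.ne_rev w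
  obtain ⟨n1, n2, n3, n4, hc⟩ := hb.bounds ha
  have hc' := hb.add_le hw ha.1
  have hr := inv_rev hw.2
  have hcand := ha.2.2
  have hta := (w.2⁻¹ a).isLt
  have htb := (w.2⁻¹ b).isLt
  have hal := a.isLt
  have hbl := b.isLt
  obtain ⟨ga1, ga2, ga3, ga4⟩ := hG a
  obtain ⟨gb1, gb2, gb3, gb4⟩ := hG b
  simp only [Fin.lt_def, Fin.le_def] at hcand
  simp only [Fin.lt_def] at a2 b2 c2 d2
  rw [cycLen, cycLen] at hc hc'
  have hga : (wmul n (OrthLM.upRefl n a b) w).1 a = 0 ∨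
      (wmul n (OrthLM.upRefl n a b) w).1 a = 1 := by
    rw [a2]; split_ifs at hc hc' ⊢ <;> omega
  have hgb : (wmul n (OrthLM.upRefl n a b) w).1 b = 0 ∨
      (wmul n (OrthLM.upRefl n a b) w).1 b = 1 := by
    rw [b2]; split_ifs at hc hc' ⊢ <;> omega
  have ha1 : ((w.2⁻¹ b : Fin (2*n)) : ℕ) < a → (wmul n (OrthLM.upRefl n a b) w).1 a = 1 := by
    rw [a2]; intro h; split_ifs at hc hc' ⊢ <;> omega
  have ha2 : (a:ℕ) < (w.2⁻¹ b : Fin (2*n)) → (wmul n (OrthLM.upRefl n a b) w).1 a = 0 := by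
    rw [a2]; intro h; split_ifs at hc hc' ⊢ <;> omega
  have hb1 : ((w.2⁻¹ a : Fin (2*n)) : ℕ) < b → (wmul n (OrthLM.upRefl n a b) w).1 b = 1 := by
    rw [b2]; intro h; split_ifs at hc hc' ⊢ <;> omega
  have hb2 : (b:ℕ) < (w.2⁻¹ a : Fin (2*n)) → (wmul n (OrthLM.upRefl n a b) w).1 b = 0 := by
    rw [b2]; intro h; split_ifs at hc hc' ⊢ <;> omega
  have hsa : (wmul n (OrthLM.upRefl n a b) w).1 a +
      (wmul n (OrthLM.upRefl n a b) w).1 a.rev = 1 := by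
    rw [a2, d2]; linarith
  have hsb : (wmul n (OrthLM.upRefl n a b) w).1 b +
      (wmul n (OrthLM.upRefl n a b) w).1 b.rev = 1 := by
    rw [b2, c2]; linarith
  clear hcand hc hc' a2 b2 c2 d2
  intro l
  by_cases l1 : l = a
  · subst l1; rw [a1]; exact ⟨hga, hsa, ha1, ha2⟩
  by_cases l2 : l = b
  · subst l2; rw [b1]; exact ⟨hgb, hsb, hb1, hb2⟩
  by_cases l3 : l = b.rev
  · subst l3; rw [c1, Fin.rev_rev, hr, Fin.val_rev, Fin.val_rev]
    refine ⟨by omega, by omega, fun h => ?_, fun h => ?_⟩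
    · have := hb2 (by omega); omega
    · have := hb1 (by omega); omega
  by_cases l4 : l = a.rev
  · subst l4; rw [d1, Fin.rev_rev, hr, Fin.val_rev, Fin.val_rev]
    refine ⟨by omega, by omega, fun h => ?_, fun h => ?_⟩
    · have := ha2 (by omega); omega
    · have := ha1 (by omega); omega
  have l5 : l.rev ≠ a := fun h => l4 (by rw [← h, Fin.rev_rev])
  have l6 : l.rev ≠ b := fun h => l3 (by rw [← h, Fin.rev_rev])
  have l7 : l.rev ≠ b.rev := fun h => l2 (Fin.rev_inj.mp h)
  have l8 : l.rev ≠ a.rev := fun h => l1 (Fin.rev_inj.mp h)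
  obtain ⟨e1, e2⟩ := hl l l1 l2 l3 l4
  rw [e1, e2, (hl l.rev l5 l6 l7 l8).2]
  exact hG l

/-- `upRefl` moves the alcove of `w` away from the base alcove. -/
lemma side_upRefl_pos (hG : GLdata n w) (hb : IsShortest n w b) (ha : IsCand n w b a) :
    (a < b → 0 < side n a b 0 (wone n) * side n a b 0 w) ∧
    (b < a → 0 < side n b a (-1) (wone n) * side n b a (-1) w) := by
  obtain ⟨n1, n2, n3, n4, hc⟩ := hb.bounds ha
  have hcand := ha.2.2
  have hta := (w.2⁻¹ a).isLt
  have htb := (w.2⁻¹ b).isLt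
  have hal := a.isLt
  have hbl := b.isLt
  obtain ⟨ga1, ga2, ga3, ga4⟩ := hG a
  obtain ⟨gb1, gb2, gb3, gb4⟩ := hG b
  clear ga2 gb2
  simp only [Fin.lt_def, Fin.le_def] at hcand ⊢
  rw [cycLen, cycLen] at hc
  simp only [side, alcPt_one]
  simp only [alcPt]
  constructor
  · intro h
    apply mul_pos_of_neg_of_neg
    · omega
    · rcases ga1 with ga1 | ga1 <;> rcases gb1 with gb1 | gb1 <;> rw [ga1, gb1] <;>
      rw [ga1] at ga3 ga4 <;> rw [gb1] at gb3 gb4 <;>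
      split_ifs at hc <;> omega
  · intro h
    apply mul_pos
    · omega
    · rcases ga1 with ga1 | ga1 <;> rcases gb1 with gb1 | gb1 <;> rw [ga1, gb1] <;>
      rw [ga1] at ga3 ga4 <;> rw [gb1] at gb3 gb4 <;>
      split_ifs at hc <;> omega

/-- For `n = 2`, `upRefl` does not leave the orbit of the base alcove under `sgens`. -/
lemma alcPt_upRefl_lt (hw : inWt n w) (hG : GLdata n w) (hb : IsShortest n w b)
    (ha : IsCand n w b a) (hn : n = 2) (i j : Fin (2*n)) (hi : (i:ℕ) = 0) (hj : (j:ℕ) = 1) :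
    alcPt n (wmul n (upRefl n a b) w) j - alcPt n (wmul n (upRefl n a b) w) i < 4 ∧
    alcPt n (wmul n (upRefl n a b) w) i - alcPt n (wmul n (upRefl n a b) w) j < 4 := by
  subst hn
  have hG' := hG.upRefl hw hb ha
  have hw' := inWt_wmul (inWt_upRefl ha.ne ha.ne_rev) hw
  obtain ⟨⟨⟨a1, a2⟩, b1, b2⟩, -⟩ := upRefl_values ha.ne ha.ne_rev w
  obtain ⟨w', hw'e⟩ : ∃ w', w' = wmul 2 (upRefl 2 a b) w := ⟨_, rfl⟩
  rw [← hw'e] at hG' hw' a1 a2 b1 b2 ⊢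
  have hbr := hb.2 b.rev (by
    rw [inv_rev hw.2]; exact fun h => hb.1 (Fin.rev_inj.mp h))
  obtain ⟨n1, n2, n3, n4, -⟩ := hb.bounds ha
  rw [inv_rev hw.2, cycLen, cycLen, Fin.val_rev, Fin.val_rev] at hbr
  have hne : (a:ℕ) ≠ b.rev := fun h => ha.2.1 (Fin.ext h)
  rw [Fin.val_rev] at hne
  obtain ⟨i1, i2, i3, i4⟩ := hG' i
  obtain ⟨j1, j2, j3, j4⟩ := hG' j
  have hti := (w'.2⁻¹ i).isLt
  have htj := (w'.2⁻¹ j).isLt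
  simp only [alcPt]
  push_cast
  by_contra hcon
  have hneij : ((w'.2⁻¹ i : Fin (2*2)) : ℕ) ≠ (w'.2⁻¹ j : Fin (2*2)) := fun h => by
    have := congrArg Fin.val ((w'.2⁻¹).injective (Fin.ext h))
    omega
  have hvi : w'.1 i = 0 ∧ ((w'.2⁻¹ i : Fin (2*2)) : ℕ) = 0 ∧ w'.1 j = 1 ∧
      ((w'.2⁻¹ j : Fin (2*2)) : ℕ) = 1 := by
    clear hbr hne a1 a2 b1 b2 hw'e
    omega
  have hall : ∀ l : Fin (2*2), ((w'.2⁻¹ l : Fin (2*2)) : ℕ) = l ∧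
      (w'.1 l = if (l:ℕ) = 1 ∨ (l:ℕ) = 3 then 1 else 0) := by
    intro l
    have hri : ((w'.2⁻¹ i.rev : Fin (2*2)) : ℕ) = i.rev := by
      rw [inv_rev hw'.2, Fin.val_rev, Fin.val_rev]; omega
    have hrj : ((w'.2⁻¹ j.rev : Fin (2*2)) : ℕ) = j.rev := by
      rw [inv_rev hw'.2, Fin.val_rev, Fin.val_rev]; omega
    have hl : l = i ∨ l = j ∨ l = i.rev ∨ l = j.rev := by
      simp only [Fin.ext_iff, Fin.val_rev]; omega
    rcases hl with rfl | rfl | rfl | rfl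
    · refine ⟨by omega, ?_⟩; rw [if_neg (by omega)]; omega
    · refine ⟨by omega, ?_⟩; rw [if_pos (by omega)]; omega
    · refine ⟨hri, ?_⟩; rw [Fin.val_rev, if_pos (by omega)]; omega
    · refine ⟨hrj, ?_⟩; rw [Fin.val_rev, if_neg (by omega)]; omega
  obtain ⟨p1, p2⟩ := hall a
  obtain ⟨q1, q2⟩ := hall b
  obtain ⟨g1, g2, g3, g4⟩ := hG a
  obtain ⟨k1, k2, k3, k4⟩ := hG b
  rw [a1] at p1
  rw [b1] at q1
  rw [a2] at p2
  rw [b2] at q2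
  have hal := a.isLt
  have hbl := b.isLt
  clear hcon hvi hall i1 i2 i3 i4 j1 j2 j3 j4 a1 a2 b1 b2
  simp only [Fin.lt_def] at p2 q2
  split_ifs at hbr p2 q2 <;> omega

end

section

variable {n : ℕ} {w : Wt n} {μ : Fin (2*n) → ℤ} {a b : Fin (2*n)}

/-- The index `k` obstructs the spin-permissibility of `upRefl n a b · w`. -/
structure Bad (n : ℕ) (w : Wt n) (μ : Fin (2*n) → ℤ) (b a : Fin (2*n)) (k : ℕ) : Prop where
  one_le : 1 ≤ k
  le : k ≤ 2*n
  arc : Arc a b k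
  not_arc : ¬ Arc a b (2*n - k)
  left : muk n w k a = 1
  right : muk n w k b = 0
  left_rev : muk n w k a.rev = 1
  right_rev : muk n w k b.rev = 0
  other : ∀ l, l ≠ a → l ≠ b → l ≠ b.rev → l ≠ a.rev → muk n w k l + muk n w k l.rev = 1
  not_orb : ¬ Orb n μ (permAct n (Equiv.swap a.rev b.rev) (muk n w k))

lemma IsCand.muk_of_arc (hw : inWt n w) (hG : GLdata n w) (hb : IsShortest n w b)
    (ha : IsCand n w b a) {k : ℕ} (hk : k ≤ 2*n) (h : Arc a b k) :
    muk n w k a = 1 ∧ muk n w k b = 0 := by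
  obtain ⟨h1, h2⟩ := (muk_upRefl ha.ne ha.ne_rev w hk).1 h
  have h3 := (hG.upRefl hw hb ha).muk_mem k a
  have h4 := (hG.upRefl hw hb ha).muk_mem k b
  have h5 := hG.muk_mem k a
  have h6 := hG.muk_mem k b
  omega

lemma bad_of_arc (hw : inWt n w) (hG : GLdata n w) (hb : IsShortest n w b)
    (ha : IsCand n w b a) {k : ℕ} (hk : k ≤ 2*n) (h : Arc a b k) (h' : ¬ Arc a b (2*n - k))
    (ht : TotIso n (muk n (wmul n (upRefl n a b) w) k))
    (ho : ¬ Orb n μ (muk n (wmul n (upRefl n a b) w) k)) : Bad n w μ b a k := by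
  obtain ⟨m1, m2⟩ := ha.muk_of_arc hw hG hb hk h
  obtain ⟨u1, -, -, u2, u3⟩ := muk_upRefl ha.ne ha.ne_rev w hk
  obtain ⟨u4, u5⟩ := u1 h
  obtain ⟨u6, u7⟩ := u2 h'
  have hta := ht a
  have htb := ht b
  have r1 := rev_ne a
  have r2 := rev_ne b
  have r3 := ha.ne
  have r4 : a.rev ≠ b.rev := fun h => r3 (Fin.rev_inj.mp h)
  refine ⟨?_, hk, h, h', m1, m2, by omega, by omega, fun l l1 l2 l3 l4 => ?_, fun hcon => ho ?_⟩
  · by_contra h0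
    obtain rfl : k = 0 := by omega
    have hal := a.isLt
    apply h'
    unfold Arc at h ⊢
    omega
  · have l5 : l.rev ≠ a := fun h => l4 (by rw [← h, Fin.rev_rev])
    have l6 : l.rev ≠ b := fun h => l3 (by rw [← h, Fin.rev_rev])
    have l7 : l.rev ≠ b.rev := fun h => l2 (Fin.rev_inj.mp h)
    have l8 : l.rev ≠ a.rev := fun h => l1 (Fin.rev_inj.mp h)
    rw [← u3 l l1 l2 l3 l4, ← u3 l.rev l5 l6 l7 l8]
    exact ht l
  · convert hcon using 1
    funext l
    simp only [permAct, Equiv.swap_inv]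
    by_cases l3 : l = b.rev
    · subst l3; rw [Equiv.swap_apply_right, u6]
    by_cases l4 : l = a.rev
    · subst l4; rw [Equiv.swap_apply_left, u7]
    rw [Equiv.swap_apply_of_ne_of_ne l4 l3]
    by_cases l1 : l = a
    · subst l1; omega
    by_cases l2 : l = b
    · subst l2; omega
    exact u3 l l1 l2 l3 l4

lemma exists_bad (hw : inWt n w) (hG : GLdata n w) (hsp : SpinPerm n μ w)
    (hb : IsShortest n w b) (ha : IsCand n w b a)
    (h : ¬ SpinPerm n μ (wmul n (upRefl n a b) w)) : ∃ k, Bad n w μ b a k := by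
  have hG' := hG.upRefl hw hb ha
  have hw' := inWt_wmul (inWt_upRefl ha.ne ha.ne_rev) hw
  obtain ⟨k, hkn, ht, ho⟩ : ∃ k ≤ n, TotIso n (muk n (wmul n (upRefl n a b) w) k) ∧
      ¬ Orb n μ (muk n (wmul n (upRefl n a b) w) k) := by
    by_contra hcon
    push Not at hcon
    exact h ⟨(gLperm_iff hw').mpr hG', hcon⟩
  have hk : k ≤ 2*n := by omega
  by_cases h1 : Arc a b k
  · by_cases h2 : Arc a b (2*n - k)
    · exfalso
      obtain ⟨u1, -, u2, -, u3⟩ := muk_upRefl ha.ne ha.ne_rev w hk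
      obtain ⟨u4, u5⟩ := u1 h1
      obtain ⟨u6, u7⟩ := u2 h2
      have e : muk n (wmul n (upRefl n a b) w) k = muk n w k := by
        have := hG.muk_mem k a
        have := hG.muk_mem k b
        have := hG.muk_mem k a.rev
        have := hG.muk_mem k b.rev
        have := hG'.muk_mem k a
        have := hG'.muk_mem k b
        have := hG'.muk_mem k a.rev
        have := hG'.muk_mem k b.rev
        funext l
        by_cases l1 : l = a
        · subst l1; omega
        by_cases l2 : l = b
        · subst l2; omega
        by_cases l3 : l = b.rev
        · subst l3; omega
        by_cases l4 : l = a.rev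
        · subst l4; omega
        exact u3 l l1 l2 l3 l4
      rw [e] at ht ho
      exact ho (hsp.orb hw hG hk ht)
    · exact ⟨k, bad_of_arc hw hG hb ha hk h1 h2 ht ho⟩
  · by_cases h2 : Arc a b (2*n - k)
    · have e : muk n (wmul n (upRefl n a b) w) (2*n - k) = muk n (wmul n (upRefl n a b) w) k := by
        funext j
        have h3 := ht j
        rw [muk_rev hw' hG' hk] at h3
        omega
      exact ⟨2*n - k, bad_of_arc hw hG hb ha (by omega) h2 (by rwa [Nat.sub_sub_self hk])
        (by rwa [e]) (by rwa [e])⟩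
    · exfalso
      obtain ⟨-, u1, -, u2, u3⟩ := muk_upRefl ha.ne ha.ne_rev w hk
      obtain ⟨u4, u5⟩ := u1 h1
      obtain ⟨u6, u7⟩ := u2 h2
      have r3 := ha.ne
      have r1 := rev_ne a
      have r2 := rev_ne b
      have r5 := ha.ne_rev
      have r6 := ha.2.1
      have r4 : a.rev ≠ b.rev := fun h => r3 (Fin.rev_inj.mp h)
      have e : muk n (wmul n (upRefl n a b) w) k =
          permAct n (Equiv.swap a b * Equiv.swap a.rev b.rev) (muk n w k) := by
        funext l
        simp only [permAct, mul_inv_rev, Equiv.swap_inv, Equiv.Perm.mul_apply]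
        by_cases l1 : l = a
        · subst l1
          rw [Equiv.swap_apply_left, Equiv.swap_apply_of_ne_of_ne r5 r2.symm, u4]
        by_cases l2 : l = b
        · subst l2
          rw [Equiv.swap_apply_right, Equiv.swap_apply_of_ne_of_ne r1.symm r6, u5]
        rw [Equiv.swap_apply_of_ne_of_ne l1 l2]
        by_cases l3 : l = b.rev
        · subst l3; rw [Equiv.swap_apply_right, u6]
        by_cases l4 : l = a.rev
        · subst l4; rw [Equiv.swap_apply_left, u7]
        rw [Equiv.swap_apply_of_ne_of_ne l4 l3]
        exact u3 l l1 l2 l3 l4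
      have ht' : TotIso n (muk n w k) := by
        intro l
        have hta := ht a
        have htb := ht b
        rw [u4, u7] at hta
        rw [u5, u6] at htb
        by_cases l1 : l = a
        · subst l1; exact htb
        by_cases l2 : l = b
        · subst l2; exact hta
        by_cases l3 : l = b.rev
        · subst l3; rw [Fin.rev_rev]; omega
        by_cases l4 : l = a.rev
        · subst l4; rw [Fin.rev_rev]; omega
        have l5 : l.rev ≠ a := fun h => l4 (by rw [← h, Fin.rev_rev])
        have l6 : l.rev ≠ b := fun h => l3 (by rw [← h, Fin.rev_rev])
        have l7 : l.rev ≠ b.rev := fun h => l2 (Fin.rev_inj.mp h)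
        have l8 : l.rev ≠ a.rev := fun h => l1 (Fin.rev_inj.mp h)
        rw [← u3 l l1 l2 l3 l4, ← u3 l.rev l5 l6 l7 l8]
        exact ht l
      rw [e] at ho
      exact ho ((hsp.orb hw hG hk ht').permAct (inW0_wrefl r3 r5))

end

section

variable {n : ℕ} {w : Wt n} {μ : Fin (2*n) → ℤ} {a a' b : Fin (2*n)}

/-- The cyclic distance from `a` to `k`. -/
def arcRank (n a k : ℕ) : ℕ := if a < k then k - a else k + 2*n - a

lemma Bad.isCand_of_forall_le {k : ℕ} (hw : inWt n w) (hG : GLdata n w) (hb : IsShortest n w b)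
    (ha : IsCand n w b a) (h : Bad n w μ b a k)
    (hmin : ∀ k', Bad n w μ b a k' → arcRank n a k ≤ arcRank n a k')
    {e : Fin (2*n)} (he : (e:ℕ) + 1 = k) : IsCand n w b e := by
  have hal := a.isLt
  have hbl := b.isLt
  have hel := e.isLt
  have harc := h.arc
  have hcand := ha.2.2
  simp only [Fin.lt_def, Fin.le_def] at hcand
  unfold Arc at harc
  refine ⟨fun hfix => ?_, fun heb => h.not_arc ?_, ?_⟩
  · have hea : (e:ℕ) ≠ a := fun hea => ha.1 (by rw [← Fin.ext hea]; exact hfix)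
    obtain ⟨k0, hk0, hk0e⟩ : ∃ k0, (1 ≤ k0 ∧ k0 ≤ 2*n ∧ Arc a b k0 ∧
        arcRank n a k0 < arcRank n a k) ∧ muk n w k0 = muk n w k := by
      have hstep : ∀ j, ((w.2⁻¹ j : Fin (2*n)) : ℕ) = e ↔ (j:ℕ) = e := by
        intro j
        rw [← Fin.ext_iff, ← Fin.ext_iff]
        constructor
        · intro hj; rw [← hfix] at hj; exact (w.2⁻¹).injective hj
        · rintro rfl; exact hfix
      by_cases he0 : (e:ℕ) = 0
      · refine ⟨2*n, ⟨by omega, le_rfl, by unfold Arc; omega, ?_⟩, ?_⟩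
        · simp only [arcRank]; split_ifs <;> omega
        · funext j
          have h1 := hstep j
          have h2 := j.isLt
          have h3 := (w.2⁻¹ j).isLt
          rw [muk_apply, muk_apply]
          split_ifs <;> omega
      · refine ⟨e, ⟨by omega, by omega, by unfold Arc; omega, ?_⟩, ?_⟩
        · simp only [arcRank]; split_ifs <;> omega
        · funext j
          have h1 := hstep j
          rw [muk_apply, muk_apply]
          split_ifs <;> omega
    refine absurd (hmin k0 ⟨hk0.1, hk0.2.1, hk0.2.2.1, fun harc' => ?_, ?_, ?_, ?_, ?_, ?_, ?_⟩)
      (not_le.mpr hk0.2.2.2)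
    · have h1 := (ha.muk_of_arc hw hG hb (by omega) harc').2
      have h2 := muk_rev hw hG hk0.2.1 b
      have h3 := h.right_rev
      rw [hk0e] at h2
      omega
    · rw [hk0e]; exact h.left
    · rw [hk0e]; exact h.right
    · rw [hk0e]; exact h.left_rev
    · rw [hk0e]; exact h.right_rev
    · rw [hk0e]; exact h.other
    · rw [hk0e]; exact h.not_orb
  · have h1 := congrArg Fin.val heb
    rw [Fin.val_rev] at h1
    unfold Arc
    omega
  · simp only [Fin.lt_def, Fin.le_def]
    omega

lemma Bad.ne_inv {k : ℕ} (hw : inWt n w) (hG : GLdata n w) (hsp : SpinPerm n μ w)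
    (ha : IsCand n w b a) (h : Bad n w μ b a k)
    {e : Fin (2*n)} (he : (e:ℕ) + 1 = k) : e ≠ w.2⁻¹ b := by
  intro heq
  have hal := a.isLt
  have hbl := b.isLt
  have harc := h.arc
  have hcand := ha.2.2
  simp only [Fin.lt_def, Fin.le_def, ← heq] at hcand
  unfold Arc at harc
  have hea : e = a := Fin.ext (by omega)
  have hstep : ∀ j, muk n w k j = muk n w a j - (if j = b then 1 else 0) +
      (if j = a then 1 else 0) := by
    intro j
    have h1 : j = b ↔ ((w.2⁻¹ j : Fin (2*n)) : ℕ) = e := by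
      rw [← Fin.ext_iff, heq]; exact ((w.2⁻¹).injective.eq_iff).symm
    simp only [muk_apply, h1, Fin.ext_iff (a := j) (b := a), ← he, hea]
    split_ifs <;> omega
  have r1 := rev_ne a
  have r2 := rev_ne b
  have r3 := ha.ne
  have r5 := ha.ne_rev
  have r6 := ha.2.1
  have r4 : a.rev ≠ b.rev := fun h => r3 (Fin.rev_inj.mp h)
  have v1 := hstep a
  have v2 := hstep b
  have v3 := hstep a.rev
  have v4 := hstep b.rev
  rw [h.left, if_neg r3, if_pos rfl] at v1
  rw [h.right, if_pos rfl, if_neg r3.symm] at v2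
  rw [h.left_rev, if_neg r5.symm, if_neg r1] at v3
  rw [h.right_rev, if_neg r2, if_neg r6.symm] at v4
  have hiso : TotIso n (muk n w a) := by
    intro l
    by_cases l1 : l = a
    · subst l1; omega
    by_cases l2 : l = b
    · subst l2; omega
    by_cases l3 : l = b.rev
    · subst l3; rw [Fin.rev_rev]; omega
    by_cases l4 : l = a.rev
    · subst l4; rw [Fin.rev_rev]; omega
    have l5 : l.rev ≠ a := fun h => l4 (by rw [← h, Fin.rev_rev])
    have l6 : l.rev ≠ b := fun h => l3 (by rw [← h, Fin.rev_rev])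
    have := h.other l l1 l2 l3 l4
    rw [hstep, hstep, if_neg l1, if_neg l2, if_neg l5, if_neg l6] at this
    omega
  have horb := (hsp.orb hw hG hal.le hiso).permAct (inW0_wrefl r3 r5)
  apply h.not_orb
  convert horb using 1
  funext l
  simp only [permAct, mul_inv_rev, Equiv.swap_inv, Equiv.Perm.mul_apply]
  by_cases l1 : l = a
  · subst l1
    rw [Equiv.swap_apply_left, Equiv.swap_apply_of_ne_of_ne r5 r2.symm,
      Equiv.swap_apply_of_ne_of_ne r1.symm r6, h.left]
    omega
  by_cases l2 : l = b
  · subst l2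
    rw [Equiv.swap_apply_right, Equiv.swap_apply_of_ne_of_ne r1.symm r6,
      Equiv.swap_apply_of_ne_of_ne r5 r2.symm, h.right]
    omega
  rw [Equiv.swap_apply_of_ne_of_ne l1 l2]
  by_cases l3 : l = b.rev
  · subst l3; rw [Equiv.swap_apply_right, h.left_rev]; omega
  by_cases l4 : l = a.rev
  · subst l4; rw [Equiv.swap_apply_left, h.right_rev]; omega
  rw [Equiv.swap_apply_of_ne_of_ne l4 l3, hstep, if_neg l1, if_neg l2]
  omega

lemma Bad.isoVec {k : ℕ} (hG : GLdata n w) (ha : IsCand n w b a) (h : Bad n w μ b a k) :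
    IsoVec n (permAct n (Equiv.swap a.rev b.rev) (muk n w k)) := by
  have r1 := rev_ne a
  have r2 := rev_ne b
  have r3 := ha.ne
  have r5 := ha.ne_rev
  have r6 := ha.2.1
  refine ⟨fun j => hG.muk_mem k _, fun l => ?_⟩
  have e1 : Equiv.swap a.rev b.rev a = a := Equiv.swap_apply_of_ne_of_ne r1.symm r6
  have e2 : Equiv.swap a.rev b.rev b = b := Equiv.swap_apply_of_ne_of_ne r5 r2.symm
  have g1 := h.left
  have g2 := h.right
  have g3 := h.left_rev
  have g4 := h.right_rev
  simp only [permAct, Equiv.swap_inv]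
  by_cases l1 : l = a
  · subst l1; rw [e1, Equiv.swap_apply_left]; omega
  by_cases l2 : l = b
  · subst l2; rw [e2, Equiv.swap_apply_right]; omega
  by_cases l3 : l = b.rev
  · subst l3; rw [Fin.rev_rev, e2, Equiv.swap_apply_right]; omega
  by_cases l4 : l = a.rev
  · subst l4; rw [Fin.rev_rev, e1, Equiv.swap_apply_left]; omega
  have l7 : l.rev ≠ b.rev := fun h => l2 (Fin.rev_inj.mp h)
  have l8 : l.rev ≠ a.rev := fun h => l1 (Fin.rev_inj.mp h)
  rw [Equiv.swap_apply_of_ne_of_ne l4 l3, Equiv.swap_apply_of_ne_of_ne l8 l7]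
  exact h.other l l1 l2 l3 l4

lemma Bad.unique {k : ℕ} (hμ : IsoVec n μ) (hG : GLdata n w) (ha : IsCand n w b a)
    (ha' : IsCand n w b a') (h : Bad n w μ b a k) (h' : Bad n w μ b a' k) : a = a' := by
  by_contra hne
  have r1 := rev_ne a
  have r2 := rev_ne b
  have r3 := ha.ne
  have r5 := ha.ne_rev
  have r6 := ha.2.1
  by_cases hr : a' = a.rev
  · subst hr
    rcases orb_or_orb_swap hμ (h.isoVec hG ha) a with ho | ho
    · exact h.not_orb ho
    · apply h'.not_orb
      convert ho using 1
      rw [← permAct_mul]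
      funext l
      have g1 := h.left
      have g2 := h.right
      have g3 := h.left_rev
      have g4 := h.right_rev
      have r4 : a.rev ≠ b.rev := fun h => r3 (Fin.rev_inj.mp h)
      simp only [permAct, mul_inv_rev, Equiv.swap_inv, Equiv.Perm.mul_apply, Fin.rev_rev]
      by_cases l1 : l = a
      · subst l1
        simp only [Equiv.swap_apply_left]
      by_cases l4 : l = a.rev
      · subst l4
        rw [Equiv.swap_apply_of_ne_of_ne r1 r4, Equiv.swap_apply_right,
          Equiv.swap_apply_of_ne_of_ne r1.symm r6]
        omega
      rw [Equiv.swap_apply_of_ne_of_ne l1 l4]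
      by_cases l3 : l = b.rev
      · subst l3
        simp only [Equiv.swap_apply_right]
        omega
      rw [Equiv.swap_apply_of_ne_of_ne l1 l3, Equiv.swap_apply_of_ne_of_ne l4 l3]
  · have := h.other a' (fun h => hne h.symm) ha'.ne ha'.2.1 hr
    rw [h'.left, h'.left_rev] at this
    omega

/-- If the interval of `b` starts at `b*`, no candidate is obstructed. -/
lemma not_bad_of_inv_eq_rev {k : ℕ} (hw : inWt n w) (hG : GLdata n w) (hq : w.2⁻¹ b = b.rev)
    (ha : IsCand n w b a) : ¬ Bad n w μ b a k := by
  intro h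
  have hal := a.isLt
  have hbl := b.isLt
  have harc := h.arc
  have hk := h.le
  have hcand := ha.2.2
  have h1 := muk_rev hw hG h.le b
  rw [h.right_rev, muk_apply, hq] at h1
  obtain ⟨g1, -, g3, g4⟩ := hG b
  rw [hq] at g3 g4
  simp only [hq, Fin.lt_def, Fin.le_def, Fin.val_rev] at hcand
  rw [Fin.val_rev] at g3 g4 h1
  unfold Arc at harc
  split_ifs at h1 <;> omega

lemma exists_isCand_of_inv_eq_rev (hμ : IsoVec n μ) (hw : inWt n w) (hG : GLdata n w)
    (hsp : SpinPerm n μ w) (hq : w.2⁻¹ b = b.rev) : ∃ a, IsCand n w b a := by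
  by_contra hcon
  have hqq : w.2⁻¹ b.rev = b := by rw [inv_rev hw.2, hq, Fin.rev_rev]
  have hbl := b.isLt
  have hall : ∀ l : Fin (2*n), l = b ∨ l = b.rev ∨ w.2⁻¹ l = l ∨
      (((b.rev : Fin (2*n)) : ℕ) < b → (l:ℕ) < b.rev ∨ (b:ℕ) < l) ∧
      ((b:ℕ) < b.rev → (b:ℕ) < l ∧ (l:ℕ) < b.rev) := by
    intro l
    by_contra hl
    push Not at hl
    refine hcon ⟨l, hl.2.2.1, hl.2.1, ?_⟩
    rw [hq]
    obtain ⟨h1, -, -, h4⟩ := hl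
    have h1' : (l:ℕ) ≠ b := fun h => h1 (Fin.ext h)
    simp only [Fin.lt_def, Fin.le_def]
    rw [Fin.val_rev] at *
    omega
  have hpair : ∀ l : Fin (2*n), l = b ∨ l = b.rev ∨ w.2⁻¹ l = l ∨
      ((((b.rev : Fin (2*n)) : ℕ) < b → (l:ℕ) < b.rev ∨ (b:ℕ) < l) ∧
      ((b:ℕ) < b.rev → (b:ℕ) < l ∧ (l:ℕ) < b.rev)) ∧
      ((((b.rev : Fin (2*n)) : ℕ) < b → ((w.2⁻¹ l : Fin (2*n)) : ℕ) < b.rev ∨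
        (b:ℕ) < (w.2⁻¹ l : Fin (2*n))) ∧
      ((b:ℕ) < b.rev → (b:ℕ) < (w.2⁻¹ l : Fin (2*n)) ∧
        ((w.2⁻¹ l : Fin (2*n)) : ℕ) < b.rev)) := by
    intro l
    rcases hall l with h | h | h | h
    · exact .inl h
    · exact .inr (.inl h)
    · exact .inr (.inr (.inl h))
    rcases hall (w.2⁻¹ l) with h' | h' | h' | h'
    · exact .inr (.inl ((w.2⁻¹).injective (h'.trans hqq.symm)))
    · exact .inl ((w.2⁻¹).injective (h'.trans hq.symm))
    · exact .inr (.inr (.inl ((w.2⁻¹).injective h')))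
    · exact .inr (.inr (.inr ⟨h, h'⟩))
  have hne := rev_ne b
  have hnev : ((b.rev : Fin (2*n)) : ℕ) ≠ b := fun h => hne (Fin.ext h)
  have hrl : ((b.rev : Fin (2*n)) : ℕ) < 2*n := b.rev.isLt
  have hrv := Fin.val_rev b
  have he1 : muk n w b.rev = muk n w (b+1) := by
    funext l
    have h2 := l.isLt
    have h3 := (w.2⁻¹ l).isLt
    simp only [muk_apply]
    rcases hpair l with rfl | rfl | h | h
    · rw [hq]; split_ifs <;> omega
    · rw [hqq]; split_ifs <;> omega
    · rw [h]; ring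
    · clear hrv; split_ifs <;> omega
  have ht1 : TotIso n (muk n w b.rev) := by
    intro l
    rw [muk_rev hw hG hrl.le, he1]
    have : 2*n - ((b.rev : Fin (2*n)) : ℕ) = b + 1 := by omega
    rw [this]
    ring
  obtain ⟨c, hc1, hc2, hc3, hc4⟩ : ∃ c, c ≤ 2*n ∧ muk n w (2*n - c) = muk n w c ∧
      ((b.rev : Fin (2*n)) : ℕ) < c ∧ ((b:ℕ) < b.rev ∨ c ≤ b) ∧
      ((b:ℕ) < b.rev → c = 2*n) := by
    rcases lt_or_gt_of_ne hnev with h | h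
    · refine ⟨n, by omega, by congr 1; omega, by omega, by omega, by omega⟩
    · refine ⟨2*n, le_rfl, ?_, by omega, by omega, by omega⟩
      funext l
      have h2 := l.isLt
      have h3 := (w.2⁻¹ l).isLt
      rw [muk_apply, muk_apply]
      split_ifs <;> omega
  have ht2 : TotIso n (muk n w c) := by
    intro l
    rw [muk_rev hw hG hc1, hc2]
    ring
  have hstep : ∀ l, muk n w c l = muk n w b.rev l - (if l = b then 1 else 0) +
      (if l = b.rev then 1 else 0) := by
    intro l
    have h2 := l.isLt
    have h3 := (w.2⁻¹ l).isLt
    by_cases l1 : l = b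
    · subst l1
      rw [if_pos rfl, if_neg hne.symm, muk_apply, muk_apply, hq]
      split_ifs <;> omega
    by_cases l2 : l = b.rev
    · subst l2
      rw [if_pos rfl, if_neg hne, muk_apply, muk_apply, hqq]
      split_ifs <;> omega
    rw [if_neg l1, if_neg l2, muk_apply, muk_apply]
    rcases hpair l with h | h | h | h
    · exact absurd h l1
    · exact absurd h l2
    · rw [h]; ring
    · clear hall hpair
      split_ifs <;> omega
  refine not_orb_swap hμ (hsp.orb hw hG hrl.le ht1) b ?_
  convert hsp.orb hw hG hc1 ht2 using 1
  have v1 := hstep b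
  have v2 := hstep b.rev
  rw [if_pos rfl, if_neg hne.symm] at v1
  rw [if_pos rfl, if_neg hne] at v2
  have v3 := ht1 b
  have v4 := hG.muk_mem c b
  have v5 := hG.muk_mem c b.rev
  have v6 := hG.muk_mem b.rev b
  have v7 := hG.muk_mem b.rev b.rev
  funext l
  simp only [permAct, Equiv.swap_inv]
  by_cases l1 : l = b
  · subst l1; rw [Equiv.swap_apply_left]; omega
  by_cases l2 : l = b.rev
  · subst l2; rw [Equiv.swap_apply_right]; omega
  rw [Equiv.swap_apply_of_ne_of_ne l1 l2, hstep, if_neg l1, if_neg l2]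
  ring

lemma exists_isCand_spinPerm (hμ : IsoVec n μ) (hw : inWt n w) (hG : GLdata n w)
    (hsp : SpinPerm n μ w) (hb : IsShortest n w b) :
    ∃ a, IsCand n w b a ∧ SpinPerm n μ (wmul n (upRefl n a b) w) := by
  classical
  by_contra hcon
  push Not at hcon
  have hbad : ∀ a, IsCand n w b a → ∃ k, Bad n w μ b a k := fun a ha =>
    exists_bad hw hG hsp hb ha (hcon a ha)
  by_cases hq : w.2⁻¹ b = b.rev
  · obtain ⟨a, ha⟩ := exists_isCand_of_inv_eq_rev hμ hw hG hsp hq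
    obtain ⟨k, hk⟩ := hbad a ha
    exact not_bad_of_inv_eq_rev hw hG hq ha hk
  have hex : ∀ a, ∃ e : Fin (2*n), IsCand n w b a → Bad n w μ b a (e + 1) ∧ IsCand n w b e := by
    intro a
    by_cases ha : IsCand n w b a
    · have hex := hbad a ha
      obtain ⟨k, hk, hmin⟩ : ∃ k, Bad n w μ b a k ∧
          ∀ k', Bad n w μ b a k' → arcRank n a k ≤ arcRank n a k' := by
        obtain ⟨k, hk, hmin⟩ := (measure (arcRank n a)).wf.has_min {k | Bad n w μ b a k} hex
        exact ⟨k, hk, fun k' hk' => not_lt.mp (hmin k' hk')⟩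
      have h1 := hk.one_le
      have h2 := hk.le
      have he : k - 1 + 1 = k := by omega
      refine ⟨⟨k - 1, by omega⟩, fun _ => ⟨?_, hk.isCand_of_forall_le hw hG hb ha hmin he⟩⟩
      simpa only [he] using hk
    · exact ⟨a, fun h => absurd h ha⟩
  choose e he using hex
  have hqc : IsCand n w b (w.2⁻¹ b) := by
    refine ⟨fun h => hb.1 ((w.2⁻¹).injective h), hq, ?_⟩
    rcases lt_or_gt_of_ne hb.1 with h | h
    · exact .inl ⟨h, le_rfl, h⟩
    · exact .inr ⟨h, .inl le_rfl⟩
  have hcard := Finset.card_le_card_of_injOn (s := univ.filter (IsCand n w b))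
    (t := (univ.filter (IsCand n w b)).erase (w.2⁻¹ b)) e
    (fun a ha => by
      have ha' := (Finset.mem_filter.mp ha).2
      obtain ⟨h1, h2⟩ := he a ha'
      exact Finset.mem_coe.mpr (Finset.mem_erase.mpr ⟨h1.ne_inv hw hG hsp ha' rfl,
        Finset.mem_filter.mpr ⟨Finset.mem_univ _, h2⟩⟩))
    (fun a ha a' ha' h => by
      have ha := (Finset.mem_filter.mp ha).2
      have ha' := (Finset.mem_filter.mp ha').2
      have h2 := (he a' ha').1
      rw [← h] at h2
      exact (he a ha).1.unique hμ hG ha ha' h2)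
  exact absurd hcard (not_le.mpr (Finset.card_erase_lt_of_mem
    (Finset.mem_filter.mpr ⟨Finset.mem_univ _, hqc⟩)))

end

/-- Let `μ ∈ {μ₁, μ₂}` and let `w ∈ Perm^sp(μ)` not be a translation
element (its image in `S^h_{2n}` is nontrivial).  Then there are `i < j` with `j ≠ i*`
and `d ∈ {0, -1}` such that `s_{i,j;d}w ∈ Perm^sp(μ)` and `w < s_{i,j;d}w` in the
Bruhat order. -/
theorem exists_reflection_up (n : ℕ) (hn : 2 ≤ n)
    (μ : Fin (2*n) → ℤ) (hμ : μ = mu1 n ∨ μ = mu2 n)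
    (w : Wt n) (hw : inWt n w) (hsp : SpinPerm n μ w) (hnt : w.2 ≠ 1) :
    ∃ (i j : Fin (2*n)) (d : ℤ), i < j ∧ j ≠ i.rev ∧ (d = 0 ∨ d = -1) ∧
      SpinPerm n μ (wmul n (wrefl n i j d) w) ∧
      wlt n hn w (wmul n (wrefl n i j d) w) := by
  have hG : GLdata n w := (gLperm_iff hw).mp hsp.1
  have hiso : IsoVec n μ := by
    rcases hμ with rfl | rfl
    · exact isoVec_mu1 n
    · exact isoVec_mu2 hn
  obtain ⟨b, hb⟩ := exists_isShortest hnt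
  obtain ⟨a, ha, hspa⟩ := exists_isCand_spinPerm hiso hw hG hsp hb
  have hside := side_upRefl_pos hG hb ha
  have hlt := alcPt_upRefl_lt hw hG hb ha
  rcases lt_or_gt_of_ne ha.ne with hab | hab
  · rw [upRefl, if_pos hab] at hspa hlt
    exact ⟨a, b, 0, hab, ha.ne_rev, .inl rfl, hspa,
      wlt_wrefl_wmul hn hw ha.ne ha.ne_rev (hside.1 hab) hlt⟩
  · rw [upRefl, if_neg hab.not_gt] at hspa hlt
    exact ⟨b, a, -1, hab, ha.2.1, .inr rfl, hspa,
      wlt_wrefl_wmul hn hw ha.ne.symm ha.2.1 (hside.2 hab) hlt⟩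

end OrthLM
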